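/- Every P″-graph is a P′-graph; more precisely, for every P″-graph D there is a construction whose root graph is D. -/

import Mathlib

/-- A graph in the sense of the paper: a finite set of edges, a finite set of
vertices, and West/East end functions (values outside `A` are irrelevant junk,
canonically `0`). -/
structure DGr where
  A : Finset ℕ
  V : Finset ℕ
  W : ℕ → ℕ
  E : ℕ → ℕ

namespace DGr

/-- The `X`-end function of a graph: `true` stands for `W`, `false` for `E`. -/
def Xf (G : DGr) : Bool → ℕ → ℕ
  | true => G.W
  | false => G.E

/-- `vs`/`es` form a semiwalk: alternating vertices and edges, each edge joining
its two neighbouring vertices in one of the two directions. -/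
def IsSemiwalk (G : DGr) (vs es : List ℕ) : Prop :=
  vs.length = es.length + 1 ∧
  (∀ v ∈ vs, v ∈ G.V) ∧ (∀ a ∈ es, a ∈ G.A) ∧
  ∀ (i a u v : ℕ), es[i]? = some a → vs[i]? = some u → vs[i + 1]? = some v →
    (G.W a = u ∧ G.E a = v) ∨ (G.W a = v ∧ G.E a = u)

/-- A semipath is a semiwalk with no repeated vertex. -/
def IsSemipath (G : DGr) (vs es : List ℕ) : Prop :=
  G.IsSemiwalk vs es ∧ vs.Nodup

/-- A semipath from `u` to `v`. -/
def SemipathFT (G : DGr) (u v : ℕ) (vs es : List ℕ) : Prop :=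
  G.IsSemipath vs es ∧ vs.head? = some u ∧ vs.getLast? = some v

/-- A walk: all edges traversed from West to East. -/
def IsWalk (G : DGr) (vs es : List ℕ) : Prop :=
  vs.length = es.length + 1 ∧
  (∀ v ∈ vs, v ∈ G.V) ∧ (∀ a ∈ es, a ∈ G.A) ∧
  ∀ (i a u v : ℕ), es[i]? = some a → vs[i]? = some u → vs[i + 1]? = some v →
    G.W a = u ∧ G.E a = v

/-- A cycle: a non-trivial closed walk with no repeated vertex except endpoints. -/
def IsCycle (G : DGr) (vs es : List ℕ) : Prop :=
  G.IsWalk vs es ∧ es ≠ [] ∧ vs.head? = vs.getLast? ∧ vs.dropLast.Nodup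

def Acyclic (G : DGr) : Prop := ∀ vs es, ¬ G.IsCycle vs es

def WeaklyConnected (G : DGr) : Prop :=
  ∀ u ∈ G.V, ∀ v ∈ G.V, u ≠ v → ∃ vs es, G.SemipathFT u v vs es

/-- `v` is an `X`-vertex: no edge has its `X̄`-end at `v`. -/
def XVertex (G : DGr) (X : Bool) (v : ℕ) : Prop :=
  v ∈ G.V ∧ ∀ a ∈ G.A, G.Xf (!X) a ≠ v

def InnerVertex (G : DGr) (v : ℕ) : Prop :=
  v ∈ G.V ∧ ¬ G.XVertex true v ∧ ¬ G.XVertex false v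

/-- `a` is an `X`-edge: its `X`-end is an `X`-vertex. -/
def XEdge (G : DGr) (X : Bool) (a : ℕ) : Prop :=
  a ∈ G.A ∧ G.XVertex X (G.Xf X a)

def InnerEdge (G : DGr) (a : ℕ) : Prop :=
  a ∈ G.A ∧ ¬ G.XEdge true a ∧ ¬ G.XEdge false a

def WEFunctional (G : DGr) : Prop :=
  ∀ (X : Bool) (a : ℕ), G.XEdge X a → ∀ b ∈ G.A, b ≠ a → G.Xf X b ≠ G.Xf X a

def WellFormed (G : DGr) : Prop := ∀ a ∈ G.A, G.W a ∈ G.V ∧ G.E a ∈ G.V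

/-- A D-graph: finite (built in), acyclic, W-E-functional, weakly connected
graph with an inner vertex. -/
def IsDGraph (G : DGr) : Prop :=
  G.WellFormed ∧ G.Acyclic ∧ G.WEFunctional ∧ G.WeaklyConnected ∧ ∃ v, G.InnerVertex v

/-- A basic D-graph: a D-graph with a single inner vertex. -/
def IsBasicDGraph (G : DGr) : Prop :=
  G.IsDGraph ∧ ∃! v, G.InnerVertex v

/-- `ψ_X(v,u,w)`: every semipath in `[v,w]` and every semipath in `[u]_{X̄}`
intersect. -/
def psi (G : DGr) (X : Bool) (v u w : ℕ) : Prop :=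
  ∀ vs₁ es₁, G.SemipathFT v w vs₁ es₁ →
    ∀ t vs₂ es₂, G.XVertex (!X) t → G.SemipathFT u t vs₂ es₂ →
      ∃ z, z ∈ vs₁ ∧ z ∈ vs₂

/-- `y ▷ [x,z]`: `y` occurs in every semipath from `x` to `z`. -/
def inAll (G : DGr) (y x z : ℕ) : Prop :=
  ∀ vs es, G.SemipathFT x z vs es → y ∈ vs

/-- `y ≺ x`: `y` is a pivot of `x` (`y` occurs in every semipath in `[x]_W`). -/
def Pivot (G : DGr) (y x : ℕ) : Prop :=
  y ≠ x ∧ ∀ t vs es, G.XVertex true t → G.SemipathFT x t vs es → y ∈ vs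

/-- `y ≺_∃ x`: `y` occurs in some semipath in `[x]_W`. -/
def PivotE (G : DGr) (y x : ℕ) : Prop :=
  y ≠ x ∧ ∃ t vs es, G.XVertex true t ∧ G.SemipathFT x t vs es ∧ y ∈ vs

/-- `v CCP(x,y)`: `v` is the closest common pivot of `x` and `y`. -/
def CCP (G : DGr) (v x y : ℕ) : Prop :=
  G.Pivot v x ∧ G.Pivot v y ∧ ∀ w, G.Pivot w x → G.Pivot w y → (G.Pivot w v ∨ w = v)

end DGr
/-- `x` precedes `y` in the list `L`. -/
def ltL (L : List ℕ) (x y : ℕ) : Prop :=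
  ∃ i j : ℕ, i < j ∧ L[i]? = some x ∧ L[j]? = some y

/-- `L : x−y−z`: `x`, `y`, `z` occur in `L` in that order or in the reverse order. -/
def BtwL (L : List ℕ) (x y z : ℕ) : Prop :=
  (ltL L x y ∧ ltL L y z) ∨ (ltL L z y ∧ ltL L y x)

/-- `L : x−y−u−z`. -/
def Btw4L (L : List ℕ) (x y u z : ℕ) : Prop :=
  (ltL L x y ∧ ltL L y u ∧ ltL L u z) ∨ (ltL L z u ∧ ltL L u y ∧ ltL L y x)

namespace DGr

/-- `L` is a list of all `X`-vertices of `G`. -/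
def IsListOfX (G : DGr) (X : Bool) (L : List ℕ) : Prop :=
  L.Nodup ∧ ∀ v, v ∈ L ↔ G.XVertex X v

/-- `L` is grounded in `G` (w.r.t. the `X`-vertices): `L : v−u−w` implies `ψ_X(v,u,w)`. -/
def GroundedIn (G : DGr) (X : Bool) (L : List ℕ) : Prop :=
  ∀ v u w, BtwL L v u w → G.psi X v u w

end DGr

/-- Two non-empty lists are compatible: they are of the forms `ΦΞ` and `ΞΨ`, or
`ΦΞΨ` and `Ξ`, for mutually disjoint lists `Φ`, `Ξ`, `Ψ` with `Ξ` non-empty. -/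
def ListCompat (L₁ L₂ : List ℕ) : Prop :=
  ∃ Φ Ξ Ψ : List ℕ, Ξ ≠ [] ∧ Φ.Nodup ∧ Ξ.Nodup ∧ Ψ.Nodup ∧
    Φ.Disjoint Ξ ∧ Φ.Disjoint Ψ ∧ Ξ.Disjoint Ψ ∧
    ((L₁ = Φ ++ Ξ ∧ L₂ = Ξ ++ Ψ) ∨ (L₂ = Φ ++ Ξ ∧ L₁ = Ξ ++ Ψ) ∨
     (L₁ = Φ ++ Ξ ++ Ψ ∧ L₂ = Ξ) ∨ (L₂ = Φ ++ Ξ ++ Ψ ∧ L₁ = Ξ))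

namespace DGr

/-- The conditions under which the juncture `G₁ □ G₂` is defined. -/
def JuncDefined (G₁ G₂ : DGr) : Prop :=
  G₁.IsDGraph ∧ G₂.IsDGraph ∧
  (G₁.A ∩ G₂.A).Nonempty ∧
  (∀ a ∈ G₁.A ∩ G₂.A, G₁.E a = G₂.W a ∧ G₁.XEdge false a ∧ G₂.XEdge true a) ∧
  G₁.V ∩ G₂.V = (G₁.A ∩ G₂.A).image G₁.E

/-- The juncture `G₁ □ G₂` of two graphs. -/
def junc (G₁ G₂ : DGr) : DGr where
  A := G₁.A ∪ G₂.A
  V := (G₁.V ∪ G₂.V) \ (G₁.A ∩ G₂.A).image G₁.E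
  W := fun a => if a ∈ G₁.A then G₁.W a else if a ∈ G₂.A then G₂.W a else 0
  E := fun a => if a ∈ G₂.A then G₂.E a else if a ∈ G₁.A then G₁.E a else 0

/-- `G₁` and `G₂` are P-compatible: the juncture is defined, and some list of all
E-vertices of `G₁` grounded in `G₁` and some list of all W-vertices of `G₂`
grounded in `G₂` are compatible. -/
def PCompat (G₁ G₂ : DGr) : Prop :=
  G₁.JuncDefined G₂ ∧
  ∃ Λ₁ Λ₂ : List ℕ,
    G₁.IsListOfX false Λ₁ ∧ G₁.GroundedIn false Λ₁ ∧
    G₂.IsListOfX true Λ₂ ∧ G₂.GroundedIn true Λ₂ ∧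
    ListCompat Λ₁ Λ₂

end DGr

/-- Constructions of P′-graphs: `Construction D L_W L_E` says that there is a
construction whose root carries the triple `(D, L_W, L_E)`. -/
inductive Construction : DGr → List ℕ → List ℕ → Prop
  | basic (G : DGr) (LW LE : List ℕ) :
      G.IsBasicDGraph → G.IsListOfX true LW → G.IsListOfX false LE →
      Construction G LW LE
  | box (GW GE : DGr) (LWW LEE Φe Ξ Ψe Φw Ψw : List ℕ) :
      Construction GW LWW (Φe ++ Ξ ++ Ψe) →
      Construction GE (Φw ++ Ξ ++ Ψw) LEE →
      GW.JuncDefined GE →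
      Ξ ≠ [] →
      (Φe = [] ∨ Φw = []) → (Ψe = [] ∨ Ψw = []) →
      Φe.Disjoint Ξ → Φe.Disjoint Ψe → Ξ.Disjoint Ψe →
      Φw.Disjoint Ξ → Φw.Disjoint Ψw → Ξ.Disjoint Ψw →
      Φe.Disjoint Φw → Φe.Disjoint Ψw → Ψe.Disjoint Φw → Ψe.Disjoint Ψw →
      Construction (GW.junc GE) (Φw ++ LWW ++ Ψw) (Φe ++ LEE ++ Ψe)

/-- A P′-graph is the root graph of a construction. -/
def IsP1Graph (G : DGr) : Prop := ∃ LW LE, Construction G LW LE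

/-- P″-graphs: basic D-graphs, closed under juncture of P-compatible pairs. -/
inductive IsP2Graph : DGr → Prop
  | basic (G : DGr) : G.IsBasicDGraph → IsP2Graph G
  | box (GW GE : DGr) : IsP2Graph GW → IsP2Graph GE → GW.PCompat GE →
      IsP2Graph (GW.junc GE)

namespace DGr

/-- `H` is a subgraph of `G`. -/
def IsSubgraph (H G : DGr) : Prop :=
  H.A ⊆ G.A ∧ H.V ⊆ G.V ∧ ∀ a ∈ H.A, H.W a = G.W a ∧ H.E a = G.E a

/-- `H` is a component of `G`: a maximal weakly connected non-empty subgraph. -/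
def IsComponent (H G : DGr) : Prop :=
  H.IsSubgraph G ∧ H.V.Nonempty ∧ H.WeaklyConnected ∧
  ∀ H' : DGr, H'.IsSubgraph G → H'.WeaklyConnected → H.IsSubgraph H' → H'.IsSubgraph H

/-- Canonical graphs: the end functions are `0` outside the edge set.  Each
component of a graph has exactly one canonical representative. -/
def Canonical (H : DGr) : Prop := ∀ a, a ∉ H.A → H.W a = 0 ∧ H.E a = 0

def IsComponentC (H G : DGr) : Prop := H.IsComponent G ∧ H.Canonical

/-- The graph left after removing the set `S` of edges from `G`. -/
def removeEdges (G : DGr) (S : Finset ℕ) : DGr := ⟨G.A \ S, G.V, G.W, G.E⟩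

end DGr

/-- The edge relation of the componential graph `C_S(D)`, on (canonical)
components of the graph obtained by removing `S` from `D`. -/
def compEdge (D : DGr) (S : Finset ℕ) (H₁ H₂ : DGr) : Prop :=
  H₁.IsComponentC (D.removeEdges S) ∧ H₂.IsComponentC (D.removeEdges S) ∧ H₁ ≠ H₂ ∧
  ∃ a ∈ S, D.W a ∈ H₁.V ∧ D.E a ∈ H₂.V

/-- `S` is a strict cutset of `D`. -/
def IsStrictCutset (D : DGr) (S : Finset ℕ) : Prop :=
  (∀ a ∈ S, D.InnerEdge a) ∧
  2 ≤ {H : DGr | H.IsComponentC (D.removeEdges S)}.ncard ∧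
  (∀ a ∈ S, ∃ H₁ H₂ : DGr, H₁.IsComponentC (D.removeEdges S) ∧
     H₂.IsComponentC (D.removeEdges S) ∧ H₁ ≠ H₂ ∧ D.W a ∈ H₁.V ∧ D.E a ∈ H₂.V) ∧
  ∀ H : DGr, ¬ Relation.TransGen (compEdge D S) H H

/-- A cocycle is a strict cutset whose removal leaves exactly two components. -/
def IsCocycle (D : DGr) (C : Finset ℕ) : Prop :=
  IsStrictCutset D C ∧ {H : DGr | H.IsComponentC (D.removeEdges C)}.ncard = 2

/-- `(DW, DE)` are (up to the choice of fresh vertices) the two D-graphs obtained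
by cutting `D` through the cocycle `C`. -/
def IsCutting (D : DGr) (C : Finset ℕ) (DW DE : DGr) : Prop :=
  ∃ (H₁ H₂ : DGr) (f : ℕ → ℕ),
    H₁.IsComponentC (D.removeEdges C) ∧ H₂.IsComponentC (D.removeEdges C) ∧ H₁ ≠ H₂ ∧
    (∀ a ∈ C, D.W a ∈ H₁.V ∧ D.E a ∈ H₂.V) ∧
    Set.InjOn f ↑C ∧ (∀ a ∈ C, f a ∉ D.V) ∧
    DW = ⟨H₁.A ∪ C, H₁.V ∪ C.image f,
          fun a => if a ∈ C then D.W a else H₁.W a,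
          fun a => if a ∈ C then f a else H₁.E a⟩ ∧
    DE = ⟨H₂.A ∪ C, H₂.V ∪ C.image f,
          fun a => if a ∈ C then f a else H₂.W a,
          fun a => if a ∈ C then D.E a else H₂.E a⟩

/-- A P‴-graph: a D-graph such that for every cocycle `C`, the two D-graphs
obtained by cutting through `C` are P-compatible. -/
def IsP3Graph (D : DGr) : Prop :=
  D.IsDGraph ∧ ∀ C DW DE, IsCocycle D C → IsCutting D C DW DE → DW.PCompat DE

/- ===== Part 1: reachability inside a set ===== -/
namespace DGr

def adj (G : DGr) (u v : ℕ) : Prop :=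
  ∃ a ∈ G.A, (G.W a = u ∧ G.E a = v) ∨ (G.W a = v ∧ G.E a = u)

theorem adj_symm {G : DGr} {u v : ℕ} (h : G.adj u v) : G.adj v u := by
  obtain ⟨a, ha, h⟩ := h
  exact ⟨a, ha, h.symm⟩

inductive Cn (G : DGr) (S : Set ℕ) : ℕ → ℕ → Prop
  | refl (u : ℕ) : u ∈ S → Cn G S u u
  | head (u v w : ℕ) : u ∈ S → G.adj u v → Cn G S v w → Cn G S u w

namespace Cn
variable {G : DGr} {S T : Set ℕ} {u v w : ℕ}

theorem left_mem (h : Cn G S u v) : u ∈ S := by cases h <;> assumption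
theorem right_mem (h : Cn G S u v) : v ∈ S := by induction h <;> assumption

theorem trans (h : Cn G S u v) (h' : Cn G S v w) : Cn G S u w := by
  induction h with
  | refl => exact h'
  | head u v w hu ha _ ih => exact head _ _ _ hu ha (ih h')

theorem symm (h : Cn G S u v) : Cn G S v u := by
  induction h with
  | refl u h => exact refl u h
  | head u v w hu ha h ih =>
    exact ih.trans (head _ _ _ h.left_mem (adj_symm ha) (refl _ hu))

theorem mono (h : Cn G S u v) (hST : S ⊆ T) : Cn G T u v := by
  induction h with
  | refl u h => exact refl u (hST h)
  | head u v w hu ha h ih => exact head _ _ _ (hST hu) ha ih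

/-- first hit -/
theorem first (h : Cn G S u v) (T : Set ℕ) :
    Cn G (S \ T) u v ∨ ∃ z ∈ T, Cn G (S \ T ∪ {z}) u z := by
  induction h with
  | refl u h =>
    by_cases hu : u ∈ T
    · exact Or.inr ⟨u, hu, refl _ (by simp)⟩
    · exact Or.inl (refl _ ⟨h, hu⟩)
  | head u v w hu ha h ih =>
    by_cases huT : u ∈ T
    · exact Or.inr ⟨u, huT, refl _ (by simp)⟩
    · rcases ih with ih | ⟨z, hz, ih⟩
      · exact Or.inl (head _ _ _ ⟨hu, huT⟩ ha ih)
      · exact Or.inr ⟨z, hz, head _ _ _ (Or.inl ⟨hu, huT⟩) ha ih⟩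

/-- last exit -/
theorem last (h : Cn G S u v) (K : Set ℕ) (hv : v ∉ K) :
    Cn G (S \ K) u v ∨ ∃ k ∈ K, ∃ z, z ∉ K ∧ G.adj k z ∧ Cn G (S \ K) z v := by
  induction h with
  | refl u h => exact Or.inl (refl _ ⟨h, hv⟩)
  | head u v w hu ha h ih =>
    rcases ih hv with ih | ih
    · by_cases huK : u ∈ K
      · exact Or.inr ⟨u, huK, v, ih.left_mem.2, ha, ih⟩
      · exact Or.inl (head _ _ _ ⟨hu, huK⟩ ha ih)
    · exact Or.inr ih

theorem split (h : Cn G S u v) (p : ℕ) : Cn G (S \ {p}) u v ∨ Cn G S p v := by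
  induction h with
  | refl u h =>
    by_cases hu : u = p
    · subst hu; exact Or.inr (refl _ h)
    · exact Or.inl (refl _ ⟨h, hu⟩)
  | head u v w hu ha h ih =>
    rcases ih with ih | ih
    · by_cases hup : u = p
      · subst hup; exact Or.inr (head _ _ _ hu ha h)
      · exact Or.inl (head _ _ _ ⟨hu, hup⟩ ha ih)
    · exact Or.inr ih

/-- a set closed up to `p` can be avoided -/
theorem avoid {K : Set ℕ} {p : ℕ} (hp : p ∉ K)
    (hK : ∀ s t, s ∈ K → G.adj s t → t ∉ K → t = p)
    (h : Cn G S u v) (hv : v ∉ K) :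
    (u ∉ K → Cn G Kᶜ u v) ∧ (u ∈ K → Cn G Kᶜ p v) := by
  induction h with
  | refl u h => exact ⟨fun h => refl _ h, fun h => absurd h hv⟩
  | head u v w hu ha h ih =>
    have ih := ih hv
    constructor
    · intro huK
      by_cases hvK : v ∈ K
      · have := hK v u hvK (adj_symm ha) huK
        subst this; exact ih.2 hvK
      · exact head _ _ _ huK ha (ih.1 hvK)
    · intro huK
      by_cases hvK : v ∈ K
      · exact ih.2 hvK
      · have := hK u v huK ha hvK
        subst this; exact ih.1 hvK

/-- stays within a closed set -/
theorem closed {K : Set ℕ} (hK : ∀ s t, s ∈ K → G.adj s t → t ∈ S → t ∈ K)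
    (h : Cn G S u v) (hu : u ∈ K) : v ∈ K ∧ Cn G (S ∩ K) u v := by
  induction h with
  | refl u h => exact ⟨hu, refl _ ⟨h, hu⟩⟩
  | head u v w hu' ha h ih =>
    have := ih (hK u v hu ha h.left_mem)
    exact ⟨this.1, head _ _ _ ⟨hu', hu⟩ ha this.2⟩

end Cn

theorem semiwalk_single (G : DGr) {u : ℕ} (hu : u ∈ G.V) : G.IsSemiwalk [u] [] := by
  refine ⟨by simp, by simpa using hu, by simp, by simp⟩

theorem semiwalk_cons (G : DGr) {u v a : ℕ} {vs es : List ℕ} :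
    G.IsSemiwalk (u :: v :: vs) (a :: es) ↔
      u ∈ G.V ∧ a ∈ G.A ∧ ((G.W a = u ∧ G.E a = v) ∨ (G.W a = v ∧ G.E a = u)) ∧
        G.IsSemiwalk (v :: vs) es := by
  constructor
  · rintro ⟨h1, h2, h3, h4⟩
    refine ⟨h2 u (by simp), h3 a (by simp), h4 0 a u v (by simp) (by simp) (by simp),
      by simpa using h1, fun z hz => h2 z (List.mem_cons_of_mem _ hz),
      fun z hz => h3 z (List.mem_cons_of_mem _ hz), ?_⟩
    intro i b s t hb hs ht
    exact h4 (i+1) b s t (by simpa using hb) (by simpa using hs) (by simpa using ht)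
  · rintro ⟨h1, h2, h3, h4, h5, h6, h7⟩
    refine ⟨by simpa using h4, ?_, ?_, ?_⟩
    · intro z hz
      rcases List.mem_cons.1 hz with rfl | hz
      · exact h1
      · exact h5 z hz
    · intro z hz
      rcases List.mem_cons.1 hz with rfl | hz
      · exact h2
      · exact h6 z hz
    · intro i b s t hb hs ht
      cases i with
      | zero =>
        simp at hb hs ht
        subst hb hs ht; exact h3
      | succ i => exact h7 i b s t (by simpa using hb) (by simpa using hs) (by simpa using ht)

theorem semiwalk_suffix (G : DGr) (u : ℕ) (l1 l2 : List ℕ) : ∀ es,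
    G.IsSemiwalk (l1 ++ u :: l2) es → ∃ es', G.IsSemiwalk (u :: l2) es' := by
  induction l1 with
  | nil => intro es h; exact ⟨es, h⟩
  | cons v l1 ih =>
    intro es h
    cases es with
    | nil => have := h.1; simp at this
    | cons a es =>
      cases l1 with
      | nil => exact ⟨es, ((G.semiwalk_cons).1 h).2.2.2⟩
      | cons v' l1 => exact ih es ((G.semiwalk_cons).1 h).2.2.2

theorem adj_mem {G : DGr} (hw : G.WellFormed) {u v : ℕ} (h : G.adj u v) : v ∈ G.V := by
  obtain ⟨a, ha, ⟨_, h⟩ | ⟨h, _⟩⟩ := h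
  · exact h ▸ (hw a ha).2
  · exact h ▸ (hw a ha).1

theorem Cn.semipath {G : DGr} {S : Set ℕ} {u v : ℕ} (h : Cn G S u v) (hw : G.WellFormed)
    (hu : u ∈ G.V) : ∃ vs es, G.SemipathFT u v vs es ∧ ∀ z ∈ vs, z ∈ S := by
  induction h with
  | refl u h =>
    exact ⟨[u], [], ⟨⟨G.semiwalk_single hu, by simp⟩, by simp, by simp⟩, by simpa using h⟩
  | head u v w hus ha h ih =>
    obtain ⟨vs, es, ⟨⟨h1, h2⟩, h3, h4⟩, h5⟩ := ih (adj_mem hw ha)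
    by_cases hm : u ∈ vs
    · obtain ⟨l1, l2, rfl⟩ := List.append_of_mem hm
      obtain ⟨es', h'⟩ := G.semiwalk_suffix _ _ _ _ h1
      refine ⟨u :: l2, es', ⟨⟨h', (List.nodup_append.1 h2).2.1⟩, by simp, ?_⟩, ?_⟩
      · rw [← h4]; simp [List.getLast?_append, List.getLast?_cons]
      · intro z hz; exact h5 z (by simp at hz ⊢; tauto)
    · cases vs with
      | nil => simp at h3
      | cons v' vs =>
        simp at h3; subst h3
        obtain ⟨a, haA, ha⟩ := ha
        refine ⟨u :: v' :: vs, a :: es, ⟨⟨(G.semiwalk_cons).2 ⟨hu, haA, ha, h1⟩,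
          List.nodup_cons.2 ⟨hm, h2⟩⟩, by simp, ?_⟩, ?_⟩
        · rw [← h4]; simp
        · intro z hz
          rcases List.mem_cons.1 hz with rfl | hz
          · exact hus
          · exact h5 z hz

theorem semiwalk_cn (G : DGr) : ∀ (vs es : List ℕ) (u v : ℕ), G.IsSemiwalk vs es →
    vs.head? = some u → vs.getLast? = some v → Cn G Set.univ u v := by
  intro vs
  induction vs with
  | nil => intro es u v _ h; simp at h
  | cons z vs ih =>
    intro es u v hs h1 h2
    simp at h1; subst h1
    cases vs with
    | nil => simp at h2; subst h2; exact Cn.refl _ trivial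
    | cons z' vs =>
      cases es with
      | nil => have := hs.1; simp at this
      | cons a es =>
        obtain ⟨_, h3, h4, h5⟩ := (G.semiwalk_cons).1 hs
        exact Cn.head _ _ _ trivial ⟨a, h3, h4⟩ (ih es z' v h5 (by simp) (by simpa using h2))

theorem WeaklyConnected.cn {G : DGr} (h : G.WeaklyConnected) {u v : ℕ} (hu : u ∈ G.V)
    (hv : v ∈ G.V) : Cn G Set.univ u v := by
  by_cases huv : u = v
  · subst huv; exact Cn.refl _ trivial
  · obtain ⟨vs, es, ⟨h1, _⟩, h2, h3⟩ := h u hu v hv huv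
    exact G.semiwalk_cn vs es u v h1 h2 h3

theorem conn_closed {G : DGr} (h : G.WeaklyConnected) {T : Set ℕ}
    (hT : ∀ a ∈ G.A, G.W a ∈ T ↔ G.E a ∈ T) {u v : ℕ} (hu : u ∈ G.V) (hv : v ∈ G.V)
    (huT : u ∈ T) : v ∈ T := by
  refine ((h.cn hu hv).closed (K := T) ?_ huT).1
  rintro s t hs ⟨a, ha, ⟨rfl, rfl⟩ | ⟨rfl, rfl⟩⟩ _
  · exact (hT a ha).1 hs
  · exact (hT a ha).2 hs

theorem psi_use {G : DGr} (hw : G.WellFormed) {v u w t : ℕ} {S T : Set ℕ}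
    (h : G.psi false v u w) (hv : v ∈ G.V) (hu : u ∈ G.V) (h1 : Cn G S v w) (h2 : Cn G T u t)
    (ht : G.XVertex true t) (hd : ∀ z, z ∈ S → z ∈ T → False) : False := by
  obtain ⟨vs, es, h3, h4⟩ := h1.semipath hw hv
  obtain ⟨vs', es', h5, h6⟩ := h2.semipath hw hu
  obtain ⟨z, hz, hz'⟩ := h vs es h3 t vs' es' ht h5
  exact hd z (h4 z hz) (h6 z hz')

/-- Menger's theorem for two paths. -/
theorem menger2 {G : DGr} (hw : G.WellFormed) {x y : ℕ} (B : Set ℕ) (hy : y ∈ G.V)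
    (h0 : ∃ b ∈ B, Cn G {y}ᶜ x b) (h1 : ∃ b ∈ B, Cn G Set.univ y b) :
    (∃ p, ∀ b ∈ B, ¬ Cn G {p}ᶜ x b ∧ ¬ Cn G {p}ᶜ y b) ∨
    (∃ U₁ U₂ : Set ℕ, (∀ z, z ∈ U₁ → z ∈ U₂ → False) ∧ (∃ b ∈ B, Cn G U₁ x b) ∧
      ∃ b ∈ B, Cn G U₂ y b) := by
  classical
  let F : Finset (Finset ℕ) := G.V.powerset.filter fun K =>
    y ∈ K ∧ (∀ k ∈ K, Cn G (↑K) y k) ∧ ∃ b ∈ B, Cn G (↑K)ᶜ x b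
  have hF : F.Nonempty := by
    refine ⟨{y}, ?_⟩
    simp only [F, Finset.mem_filter, Finset.mem_powerset]
    refine ⟨by simpa using hy, by simp, ?_, by simpa using h0⟩
    intro k hk
    simp at hk; subst hk
    exact Cn.refl _ (by simp)
  obtain ⟨K, hKF, hKmax⟩ := F.exists_max_image Finset.card hF
  simp only [F, Finset.mem_filter, Finset.mem_powerset] at hKF hKmax
  obtain ⟨hKV, hyK, hKc, hKx⟩ := hKF
  by_cases hKB : ∃ b ∈ B, b ∈ K
  · obtain ⟨b, hb, hbK⟩ := hKB
    exact Or.inr ⟨(↑K)ᶜ, ↑K, fun z h h' => h h', hKx, b, hb, hKc b hbK⟩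
  left
  have hKB : ∀ b ∈ B, b ∉ (K : Set ℕ) := fun b hb h => hKB ⟨b, hb, by simpa using h⟩
  -- neighbours of K
  have hN : ∀ k ∈ (K : Set ℕ), ∀ v, v ∉ (K : Set ℕ) → G.adj k v →
      ∀ b ∈ B, ¬ Cn G (insert v (K : Set ℕ))ᶜ x b := by
    intro k hk v hv ha b hb hc
    have hv' : v ∉ K := by simpa using hv
    have := hKmax (insert v K) ⟨?_, ?_, ?_, b, hb, ?_⟩
    · rw [Finset.card_insert_of_notMem hv'] at this; omega
    · intro z hz
      rcases Finset.mem_insert.1 hz with rfl | hz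
      · exact adj_mem hw ha
      · exact hKV hz
    · simp [hyK]
    · intro z hz
      rcases Finset.mem_insert.1 hz with rfl | hz
      · have h2 : Cn G (↑(insert z K)) y k := (hKc k (by simpa using hk)).mono (by simp)
        exact h2.trans (Cn.head _ _ _ h2.right_mem ha (Cn.refl _ (by simp)))
      · exact (hKc z hz).mono (by simp)
    · simpa using hc
  let N : Finset ℕ := G.V.filter fun v => v ∉ K ∧ ∃ k ∈ K, G.adj k v
  have hNe : N.Nonempty := by
    obtain ⟨b, hb, h1⟩ := h1
    rcases h1.last K (hKB b hb) with h | ⟨k, hk, z, hz, ha, _⟩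
    · exact absurd (by simpa using hyK) h.left_mem.2
    · refine ⟨z, ?_⟩
      simp only [N, Finset.mem_filter]
      exact ⟨adj_mem hw ha, by simpa using hz, k, by simpa using hk, ha⟩
  let R : ℕ → Finset ℕ := fun v => G.V.filter fun w => ∃ b ∈ B, Cn G (insert v (K : Set ℕ))ᶜ w b
  obtain ⟨p, hpN, hpmin⟩ := N.exists_min_image (fun v => (R v).card) hNe
  have hN' : ∀ v ∈ N, v ∉ (K : Set ℕ) ∧ ∀ b ∈ B, ¬ Cn G (insert v (K : Set ℕ))ᶜ x b := by
    intro v hv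
    simp only [N, Finset.mem_filter] at hv
    obtain ⟨_, h2, k, hk, ha⟩ := hv
    exact ⟨by simpa using h2, hN k (by simpa using hk) v (by simpa using h2) ha⟩
  have key : ∀ v ∈ N, ∀ b ∈ B, ¬ Cn G (insert p (K : Set ℕ))ᶜ v b := by
    intro v hv b hb hc
    have hlt : (R v).card < (R p).card := by
      apply Finset.card_lt_card
      rw [Finset.ssubset_iff_of_subset]
      · refine ⟨v, ?_, ?_⟩
        · simp only [R, Finset.mem_filter]
          exact ⟨(Finset.mem_filter.1 hv).1, b, hb, hc⟩
        · simp only [R, Finset.mem_filter]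
          rintro ⟨_, b', _, h'⟩
          exact h'.left_mem (by simp)
      · intro w hwR
        simp only [R, Finset.mem_filter] at hwR ⊢
        obtain ⟨hwV, b', hb', hc'⟩ := hwR
        refine ⟨hwV, ?_⟩
        rcases hc'.split p with h | h
        · exact ⟨b', hb', h.mono (by intro z hz; simp at hz ⊢; tauto)⟩
        · exfalso
          obtain ⟨b0, hb0, hx⟩ := hKx
          rcases hx.first {v, p} with h2 | ⟨u, hu, h2⟩
          · exact (hN' p hpN).2 b0 hb0 (h2.mono (by intro z hz; simp at hz ⊢; tauto))
          · simp at hu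
            by_cases hvp : v = p
            · subst hvp; exact hc.left_mem (by simp)
            rcases hu with rfl | rfl
            · refine (hN' p hpN).2 b hb (Cn.trans (h2.mono ?_) hc)
              intro z hz
              have := (hN' u hv).1
              simp at hz this ⊢
              rcases hz with rfl | hz
              · exact ⟨hvp, this⟩
              · tauto
            · refine (hN' v hv).2 b' hb' (Cn.trans (h2.mono ?_) h)
              intro z hz
              have := (hN' u hpN).1
              simp at hz this ⊢
              rcases hz with rfl | hz
              · exact ⟨fun h => hvp h.symm, this⟩
              · tauto
    exact absurd (hpmin v hv) (by omega)
  have main : ∀ u b, b ∈ B → (u ∈ K ∨ u = x) → ¬ Cn G {p}ᶜ u b := by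
    intro u b hb hu hc
    rcases hc.last K (hKB b hb) with h | ⟨k, hk, z, hz, ha, h⟩
    · rcases hu with hu | rfl
      · exact h.left_mem.2 (by simpa using hu)
      · exact (hN' p hpN).2 b hb (h.mono (by intro z hz; simp at hz ⊢; tauto))
    · refine key z ?_ b hb (h.mono (by intro z hz; simp at hz ⊢; tauto))
      simp only [N, Finset.mem_filter]
      exact ⟨adj_mem hw ha, by simpa using hz, k, by simpa using hk, ha⟩
  exact ⟨p, fun b hb => ⟨main x b hb (Or.inr rfl), main y b hb (Or.inl hyK)⟩⟩

end DGr

/- ===== Part 2: lists ===== -/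

theorem ltL_iff {L : List ℕ} (hL : L.Nodup) {x y : ℕ} :
    ltL L x y ↔ y ∈ L ∧ L.idxOf x < L.idxOf y := by
  constructor
  · rintro ⟨i, j, hij, hx, hy⟩
    obtain ⟨hi, rfl⟩ := List.getElem?_eq_some_iff.1 hx
    obtain ⟨hj, rfl⟩ := List.getElem?_eq_some_iff.1 hy
    rw [hL.idxOf_getElem, hL.idxOf_getElem]
    exact ⟨List.getElem_mem _, hij⟩
  · rintro ⟨hy, h⟩
    have hj := List.idxOf_lt_length_iff.2 hy
    refine ⟨_, _, h, ?_, ?_⟩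
    · rw [List.getElem?_eq_some_iff]; exact ⟨by omega, List.getElem_idxOf (by omega)⟩
    · rw [List.getElem?_eq_some_iff]; exact ⟨by omega, List.getElem_idxOf (by omega)⟩

theorem ltL_of_append {l1 l2 : List ℕ} {x y : ℕ} (hx : x ∈ l1) (hy : y ∈ l2) :
    ltL (l1 ++ l2) x y := by
  obtain ⟨i, hi, rfl⟩ := List.getElem_of_mem hx
  obtain ⟨j, hj, rfl⟩ := List.getElem_of_mem hy
  refine ⟨i, l1.length + j, by omega, ?_, ?_⟩
  · rw [List.getElem?_append_left hi]; simp [hi]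
  · rw [List.getElem?_append_right (by omega)]; simp [hj]

theorem BtwL_iff {L : List ℕ} (hL : L.Nodup) {x y z : ℕ} :
    BtwL L x y z ↔ x ∈ L ∧ y ∈ L ∧ z ∈ L ∧
      ((L.idxOf x < L.idxOf y ∧ L.idxOf y < L.idxOf z) ∨
       (L.idxOf z < L.idxOf y ∧ L.idxOf y < L.idxOf x)) := by
  have key : ∀ a b, b ∈ L → L.idxOf a < L.idxOf b → a ∈ L := by
    intro a b hb h
    rw [← List.idxOf_lt_length_iff] at hb ⊢; omega
  unfold BtwL
  rw [ltL_iff hL, ltL_iff hL, ltL_iff hL, ltL_iff hL]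
  constructor
  · rintro (⟨⟨h1, h2⟩, h3, h4⟩ | ⟨⟨h1, h2⟩, h3, h4⟩)
    · exact ⟨key _ _ h1 h2, h1, h3, Or.inl ⟨h2, h4⟩⟩
    · exact ⟨h3, h1, key _ _ h1 h2, Or.inr ⟨h2, h4⟩⟩
  · rintro ⟨h1, h2, h3, ⟨h4, h5⟩ | ⟨h4, h5⟩⟩
    · exact Or.inl ⟨⟨h2, h4⟩, h3, h5⟩
    · exact Or.inr ⟨⟨h2, h4⟩, h1, h5⟩

theorem BtwL.symm {L : List ℕ} {x y z : ℕ} (h : BtwL L x y z) : BtwL L z y x := Or.symm h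

theorem prefix_split (P : ℕ → Prop) (s : List ℕ)
    (h : ∀ l d r e, s = l ++ d :: r → ¬ P d → e ∈ r → ¬ P e) :
    ∃ k k', s = k ++ k' ∧ (∀ z ∈ k, P z) ∧ ∀ z ∈ k', ¬ P z := by
  induction s with
  | nil => exact ⟨[], [], by simp⟩
  | cons a s ih =>
    by_cases ha : P a
    · obtain ⟨k, k', h1, h2, h3⟩ := ih (fun l d r e he => h (a :: l) d r e (by simp [he]))
      refine ⟨a :: k, k', by simp [h1], ?_, h3⟩
      simpa [ha] using h2
    · refine ⟨[], a :: s, by simp, by simp, ?_⟩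
      intro z hz
      rcases List.mem_cons.1 hz with rfl | hz
      · exact ha
      · exact h [] a s z (by simp) ha hz

/-- convexity of a set in a list -/
def Cvx (L : List ℕ) (K : Set ℕ) : Prop := ∀ u d v, BtwL L u d v → u ∈ K → v ∈ K → d ∈ K

theorem cvx_prefix {l1 s l2 : List ℕ} {a : ℕ} {K : Set ℕ} (hc : Cvx (l1 ++ (a :: s) ++ l2) K)
    (ha : a ∈ K) :
    ∃ k k', a :: s = k ++ k' ∧ (∀ z ∈ k, z ∈ K) ∧ ∀ z ∈ k', z ∉ K := by
  apply prefix_split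
  intro l d r e hs hd he heK
  cases l with
  | nil => simp at hs; exact hd (hs.1 ▸ ha)
  | cons a' l =>
    simp at hs
    obtain ⟨rfl, rfl⟩ := hs
    refine hd (hc a d e (Or.inl ⟨?_, ?_⟩) ha heK)
    · have := ltL_of_append (l1 := l1 ++ [a]) (l2 := l ++ d :: r ++ l2) (x := a) (y := d)
        (by simp) (by simp)
      simpa using this
    · have := ltL_of_append (l1 := l1 ++ a :: l ++ [d]) (l2 := r ++ l2) (x := d) (y := e)
        (by simp) (by simp [he])
      simpa using this

section abstract_lists
variable (R : List ℕ → Prop) (Sp : Set (Set ℕ)) (Λ : List ℕ)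

theorem claimC (hΛ : Λ.Nodup) (hnd : ∀ L, R L → L.Nodup ∧ ∀ z, z ∈ L ↔ z ∈ Λ)
    (hrev : ∀ l1 s l2 K, K ∈ Sp → R (l1 ++ s ++ l2) → (∀ z ∈ s, z ∈ K) → (∀ z ∈ l1, z ∉ K) →
      (∀ z ∈ l2, z ∉ K) → R (l1 ++ s.reverse ++ l2))
    (hint : ∀ K ∈ Sp, ∀ K' ∈ Sp, K ∩ K' ∈ Sp)
    (hT : ∀ L a x b, R L → BtwL L a x b → BtwL Λ x a b →
      ∃ K ∈ Sp, x ∈ K ∧ a ∈ K ∧ b ∉ K ∧ Cvx L K) (x : ℕ) :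
    ∀ n, ∀ K ∈ Sp, ∀ l1 s l2, s.length ≤ n → R (l1 ++ s ++ l2) → (∀ z ∈ s, z ∈ K) →
      (∀ z ∈ l1, z ∉ K) → (∀ z ∈ l2, z ∉ K) → x ∈ s → (∀ y ∈ s, y ≠ x → ltL Λ x y) →
      ∃ s', R (l1 ++ (x :: s') ++ l2) := by
  intro n
  induction n with
  | zero =>
    intro K _ l1 s l2 hs _ _ _ _ hx
    cases s <;> simp_all
  | succ n ih =>
    intro K hK l1 s l2 hs hR hsK h1K h2K hx hfirst
    -- the main case
    have main : ∀ a m b, (a :: (m ++ [b])).length ≤ n + 1 → R (l1 ++ (a :: (m ++ [b])) ++ l2) →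
        (∀ z ∈ a :: (m ++ [b]), z ∈ K) → x ∈ m →
        (∀ y ∈ a :: (m ++ [b]), y ≠ x → ltL Λ x y) → ltL Λ a b →
        ∃ s', R (l1 ++ (x :: s') ++ l2) := by
      intro a m b hlen hR hsK hx hfirst hab
      have hnd' := (hnd _ hR).1
      have hax : a ≠ x := by
        rintro rfl
        simp [List.nodup_append, hx] at hnd'
      have hbt : BtwL (l1 ++ (a :: (m ++ [b])) ++ l2) a x b := by
        refine Or.inl ⟨?_, ?_⟩
        · have := ltL_of_append (l1 := l1 ++ [a]) (l2 := m ++ [b] ++ l2) (x := a) (y := x)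
            (by simp) (by simp [hx])
          simpa using this
        · have := ltL_of_append (l1 := l1 ++ a :: m) (l2 := b :: l2) (x := x) (y := b)
            (by simp [hx]) (by simp)
          simpa using this
      obtain ⟨K', hK', hxK', haK', hbK', hcv⟩ := hT _ a x b hR hbt
        (Or.inl ⟨hfirst a (by simp) hax, hab⟩)
      obtain ⟨k, k', hkk, hkK, hkK'⟩ := cvx_prefix hcv haK'
      have hmem : ∀ z, z ∈ a :: (m ++ [b]) ↔ z ∈ k ∨ z ∈ k' := by
        intro z; rw [hkk]; simp
      have hbk' : b ∈ k' := by
        rcases (hmem b).1 (by simp) with h | h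
        · exact absurd (hkK b h) hbK'
        · exact h
      have hxk : x ∈ k := by
        rcases (hmem x).1 (by simp [hx]) with h | h
        · exact h
        · exact absurd hxK' (hkK' x h)
      have hlen' : k.length ≤ n := by
        have h3 := congrArg List.length hkk
        have h4 : 0 < k'.length := List.length_pos_of_mem hbk'
        rw [List.length_append] at h3
        omega
      rw [hkk] at hR
      obtain ⟨s', hs'⟩ := ih (K ∩ K') (hint K hK K' hK') l1 k (k' ++ l2) hlen'
        (by simpa using hR) (fun z hz => ⟨hsK z ((hmem z).2 (Or.inl hz)), hkK z hz⟩)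
        (fun z hz h => h1K z hz h.1)
        (fun z hz h => by
          rcases List.mem_append.1 hz with hz | hz
          · exact hkK' z hz h.2
          · exact h2K z hz h.1) hxk (fun y hy => hfirst y ((hmem y).2 (Or.inl hy)))
      exact ⟨s' ++ k', by simpa using hs'⟩
    -- shape of s
    cases s with
    | nil => simp at hx
    | cons a s =>
      by_cases hax : a = x
      · subst hax; exact ⟨s, hR⟩
      have hxs : x ∈ s := by
        rcases List.mem_cons.1 hx with h | h
        · exact absurd h.symm hax
        · exact h
      rcases List.eq_nil_or_concat s with rfl | ⟨m, b, hsm⟩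
      · simp at hxs
      rw [List.concat_eq_append] at hsm
      subst hsm
      by_cases hbx : b = x
      · subst hbx
        have := hrev l1 (a :: (m ++ [b])) l2 K hK hR hsK h1K h2K
        exact ⟨m.reverse ++ [a], by simpa using this⟩
      have hxm : x ∈ m := by
        simp at hxs
        rcases hxs with h | h
        · exact h
        · exact absurd h.symm hbx
      have hmemΛ : ∀ z ∈ a :: (m ++ [b]), z ∈ Λ := by
        intro z hz
        refine ((hnd _ hR).2 z).1 ?_
        simp only [List.mem_append]; exact Or.inl (Or.inr hz)
      have hab : a ≠ b := by
        rintro rfl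
        have := (hnd _ hR).1
        simp [List.nodup_append] at this
      have haΛ := hmemΛ a (by simp)
      have hbΛ := hmemΛ b (by simp)
      have hne : Λ.idxOf a ≠ Λ.idxOf b := fun h => hab ((List.idxOf_inj haΛ).1 h)
      rcases lt_or_gt_of_ne hne with h | h
      · exact main a m b hs hR hsK hxm hfirst ((ltL_iff hΛ).2 ⟨hbΛ, h⟩)
      · have hR' := hrev l1 (a :: (m ++ [b])) l2 K hK hR hsK h1K h2K
        refine main b m.reverse a (by simpa using hs) (by simpa using hR') ?_ (by simpa using hxm)
          ?_ ((ltL_iff hΛ).2 ⟨haΛ, h⟩)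
        · intro z hz; exact hsK z (by simp at hz ⊢; tauto)
        · intro z hz; exact hfirst z (by simp at hz ⊢; tauto)

theorem list_main (hΛ : Λ.Nodup) (hnd : ∀ L, R L → L.Nodup ∧ ∀ z, z ∈ L ↔ z ∈ Λ)
    (hrev : ∀ l1 s l2 K, K ∈ Sp → R (l1 ++ s ++ l2) → (∀ z ∈ s, z ∈ K) → (∀ z ∈ l1, z ∉ K) →
      (∀ z ∈ l2, z ∉ K) → R (l1 ++ s.reverse ++ l2))
    (hint : ∀ K ∈ Sp, ∀ K' ∈ Sp, K ∩ K' ∈ Sp) (huniv : Set.univ ∈ Sp)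
    (hT : ∀ L a x b, R L → BtwL L a x b → BtwL Λ x a b →
      ∃ K ∈ Sp, x ∈ K ∧ a ∈ K ∧ b ∉ K ∧ Cvx L K) (L : List ℕ) (hL : R L) : R Λ := by
  have step : ∀ pre post, Λ = pre ++ post → ∃ M, R (pre ++ M) := by
    intro pre
    induction pre using List.reverseRecOn with
    | nil => intro post _; exact ⟨L, by simpa using hL⟩
    | append_singleton pre x ih =>
      intro post hpp
      obtain ⟨M, hM⟩ := ih ([x] ++ post) (by simpa using hpp)
      have hndM := (hnd _ hM).1
      have hΛ' := hΛ
      rw [hpp] at hΛ'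
      have hxpre : x ∉ pre := by
        intro h; simp [List.nodup_append] at hΛ'
        exact (hΛ'.2.2 x h).1 rfl
      have hxM : x ∈ M := by
        have : x ∈ pre ++ M := ((hnd _ hM).2 x).2 (by rw [hpp]; simp)
        rcases List.mem_append.1 this with h | h
        · exact absurd h hxpre
        · exact h
      have hpost : ∀ y ∈ M, y ≠ x → y ∈ post := by
        intro y hy hyx
        have h1 : y ∈ Λ := ((hnd _ hM).2 y).1 (by simp [hy])
        rw [hpp] at h1
        simp at h1
        rcases h1 with h1 | h1 | h1
        · exact absurd rfl ((List.nodup_append.1 hndM).2.2 y h1 y hy)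
        · exact absurd h1 hyx
        · exact h1
      have hfirst : ∀ y ∈ M, y ≠ x → ltL Λ x y := by
        intro y hy hyx
        rw [hpp]
        exact ltL_of_append (by simp) (hpost y hy hyx)
      cases M with
      | nil => simp at hxM
      | cons a M =>
        by_cases hax : a = x
        · subst hax; exact ⟨M, by simpa using hM⟩
        have hxM' : x ∈ M := by
          rcases List.mem_cons.1 hxM with h | h
          · exact absurd h.symm hax
          · exact h
        rcases List.eq_nil_or_concat pre with hpre | ⟨pre', q, hpre⟩
        · subst hpre
          obtain ⟨s', hs'⟩ := claimC R Sp Λ hΛ hnd hrev hint hT x _ Set.univ huniv [] (a :: M) []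
            le_rfl (by simpa using hM) (by simp) (by simp) (by simp) hxM hfirst
          exact ⟨s', by simpa using hs'⟩
        · rw [List.concat_eq_append] at hpre
          subst hpre
          obtain ⟨K, hK, haK, hxK, hqK, hcv⟩ := hT _ x a q hM
            (by
              refine Or.inr ⟨?_, ?_⟩
              · exact ltL_of_append (by simp) (by simp)
              · have := ltL_of_append (l1 := pre' ++ [q] ++ [a]) (l2 := M) (x := a) (y := x)
                  (by simp) hxM'
                simpa using this)
            (by
              refine Or.inr ⟨?_, hfirst a (by simp) hax⟩
              have := ltL_of_append (l1 := pre' ++ [q]) (l2 := x :: post) (x := q) (y := x)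
                  (by simp) (by simp)
              rw [hpp]; simpa using this)
          obtain ⟨k, k', hkk, hkK, hkK'⟩ :=
            cvx_prefix (l1 := pre' ++ [q]) (l2 := []) (by simpa using hcv) haK
          have hxk : x ∈ k := by
            rw [hkk] at hxM
            rcases List.mem_append.1 hxM with h | h
            · exact h
            · exact absurd hxK (hkK' x h)
          have hpreK : ∀ z ∈ pre' ++ [q], z ∉ K := by
            intro z hz hzK
            rcases List.mem_append.1 hz with hz | hz
            · refine hqK (hcv z q a (Or.inl ⟨?_, ?_⟩) hzK haK)
              · have := ltL_of_append (l1 := pre') (l2 := q :: a :: M) (x := z) (y := q)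
                  hz (by simp)
                simpa using this
              · exact ltL_of_append (by simp) (by simp)
            · simp at hz; exact hqK (hz ▸ hzK)
          rw [hkk] at hM
          obtain ⟨s', hs'⟩ := claimC R Sp Λ hΛ hnd hrev hint hT x _ K hK (pre' ++ [q]) k k'
            le_rfl (by simpa using hM) hkK hpreK hkK' hxk
            (fun y hy => hfirst y (by rw [hkk]; simp [hy]))
          exact ⟨s' ++ k', by simpa using hs'⟩
  obtain ⟨M, hM⟩ := step Λ [] (by simp)
  have : M = [] := by
    rw [List.eq_nil_iff_forall_not_mem]
    intro z hz
    have h1 : z ∈ Λ := ((hnd _ hM).2 z).1 (by simp [hz])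
    exact absurd rfl ((List.nodup_append.1 (hnd _ hM).1).2.2 z h1 z hz)
  subst this
  simpa using hM
end abstract_lists

/- ===== Part 3: separation ===== -/
namespace DGr

def Sep (G : DGr) (K : Set ℕ) (p : ℕ) : Prop :=
  (∀ z ∈ K, z ∈ G.V) ∧ p ∉ K ∧ (∀ s t, s ∈ K → G.adj s t → t ∉ K → t = p) ∧
    ∀ w, G.XVertex true w → w ∉ K

theorem sep_inter {G : DGr} (hc : G.WeaklyConnected) {w : ℕ} (hw : G.XVertex true w)
    {K K' : Set ℕ} {p p' : ℕ} (h : G.Sep K p) (h' : G.Sep K' p') :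
    ∃ q, G.Sep (K ∩ K') q := by
  obtain ⟨h1, h2, h3, h4⟩ := h
  obtain ⟨h1', h2', h3', h4'⟩ := h'
  by_cases hp' : p' ∈ K
  · by_cases hp : p ∈ K'
    · exfalso
      have := ((hc.cn (h1 p' hp') hw.1).closed (K := K ∪ K') ?_ (Or.inl hp')).1
      · rcases this with h | h
        · exact h4 w hw h
        · exact h4' w hw h
      · rintro s t (hs | hs) ha _
        · by_cases ht : t ∈ K
          · exact Or.inl ht
          · have := h3 s t hs ha ht; subst this; exact Or.inr hp
        · by_cases ht : t ∈ K'
          · exact Or.inr ht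
          · have := h3' s t hs ha ht; subst this; exact Or.inl hp'
    · refine ⟨p', fun z hz => h1 z hz.1, fun h => h2' h.2, ?_, fun w hw h => h4 w hw h.1⟩
      rintro s t ⟨hs, hs'⟩ ha ht
      by_cases htK : t ∈ K'
      · have htK2 : t ∉ K := fun h => ht ⟨h, htK⟩
        have := h3 s t hs ha htK2
        subst this; exact absurd htK hp
      · exact h3' s t hs' ha htK
  · refine ⟨p, fun z hz => h1 z hz.1, fun h => h2 h.1, ?_, fun w hw h => h4 w hw h.1⟩
    rintro s t ⟨hs, hs'⟩ ha ht
    by_cases htK : t ∈ K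
    · have htK2 : t ∉ K' := fun h => ht ⟨htK, h⟩
      have := h3' s t hs' ha htK2
      subst this; exact absurd htK hp'
    · exact h3 s t hs ha htK

theorem leaf_nbr {G : DGr} (hf : G.WEFunctional) {x : ℕ} (hx : G.XVertex false x) :
    ∃ q, q ≠ x ∧ ∀ t, G.adj x t → t = q := by
  have hx2 : ∀ a ∈ G.A, G.W a ≠ x := hx.2
  by_cases h : ∃ a ∈ G.A, G.E a = x
  · obtain ⟨a, ha, hax⟩ := h
    refine ⟨G.W a, hx2 a ha, ?_⟩
    rintro t ⟨b, hb, ⟨h1, _⟩ | ⟨h1, h2⟩⟩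
    · exact absurd h1 (hx2 b hb)
    · by_cases hba : b = a
      · subst hba; exact h1.symm
      · exact absurd (h2.trans hax.symm) (hf false a ⟨ha, by simpa [Xf, hax] using hx⟩ b hb hba)
  · refine ⟨x + 1, by omega, ?_⟩
    rintro t ⟨b, hb, ⟨h1, _⟩ | ⟨h1, h2⟩⟩
    · exact absurd h1 (hx2 b hb)
    · exact absurd ⟨b, hb, h2⟩ h

theorem leaf_avoid {G : DGr} (hf : G.WEFunctional) (hc : G.WeaklyConnected) {x u v : ℕ}
    (hx : G.XVertex false x) (hu : u ∈ G.V) (hv : v ∈ G.V) (hux : u ≠ x) (hvx : v ≠ x) :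
    Cn G {x}ᶜ u v := by
  obtain ⟨q, hq, h⟩ := leaf_nbr hf hx
  refine ((hc.cn hu hv).avoid (K := {x}) (p := q) (by simpa using hq) ?_ (by simpa using hvx)).1
    (by simpa using hux)
  rintro s t hs ha _
  simp at hs; subst hs; exact h t ha

theorem lemT {G : DGr} (hw : G.WellFormed) (hf : G.WEFunctional) (hc : G.WeaklyConnected)
    {x y z : ℕ} (hx : G.XVertex false x) (hy : G.XVertex false y) (hz : G.XVertex false z)
    (hxy : x ≠ y) (hxz : x ≠ z) (hyz : y ≠ z)
    (h1 : G.psi false x y z) (h2 : G.psi false y x z) :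
    ∃ p, p ≠ x ∧ p ≠ y ∧ ∀ b, (b = z ∨ G.XVertex true b) →
      ¬ Cn G {p}ᶜ x b ∧ ¬ Cn G {p}ᶜ y b := by
  rcases menger2 hw (x := x) (y := y) {b | b = z ∨ G.XVertex true b} hy.1
    ⟨z, Or.inl rfl, leaf_avoid hf hc hy hx.1 hz.1 hxy hyz.symm⟩
    ⟨z, Or.inl rfl, hc.cn hy.1 hz.1⟩ with ⟨p, hp⟩ | ⟨U₁, U₂, hd, ⟨b₁, hb₁, hc₁⟩, b₂, hb₂, hc₂⟩
  · refine ⟨p, ?_, ?_, hp⟩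
    · rintro rfl
      exact (hp z (Or.inl rfl)).2 (leaf_avoid hf hc hx hy.1 hz.1 hxy.symm hxz.symm)
    · rintro rfl
      exact (hp z (Or.inl rfl)).1 (leaf_avoid hf hc hy hx.1 hz.1 hxy hyz.symm)
  · exfalso
    have hd' : ∀ z, z ∈ U₂ → z ∈ U₁ → False := fun z a b => hd z b a
    rcases hb₁ with rfl | hb₁
    · rcases hb₂ with rfl | hb₂
      · exact hd _ hc₁.right_mem hc₂.right_mem
      · exact psi_use hw h1 hx.1 hy.1 hc₁ hc₂ hb₂ hd
    · rcases hb₂ with rfl | hb₂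
      · exact psi_use hw h2 hy.1 hx.1 hc₂ hc₁ hb₁ hd'
      · -- both reach W; follow z to the union
        let V₁ : Set ℕ := {v | Cn G U₁ x v}
        let V₂ : Set ℕ := {v | Cn G U₂ y v}
        have hV : ∀ v, v ∈ V₁ → v ∈ V₂ → False := fun v a b => hd v a.right_mem b.right_mem
        rcases (hc.cn hz.1 hx.1).first (V₁ ∪ V₂) with h | ⟨u, hu, h⟩
        · exact h.right_mem.2 (Or.inl (Cn.refl _ hc₁.left_mem))
        · have e1 : ∀ v, Cn G U₁ x v → Cn G V₁ x v := by
            intro v hv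
            refine (hv.closed (K := V₁) ?_ (Cn.refl _ hc₁.left_mem)).2.mono (fun _ h => h.2)
            intro s t hs ha ht
            exact Cn.trans hs (Cn.head _ _ _ hs.right_mem ha (Cn.refl _ ht))
          have e2 : ∀ v, Cn G U₂ y v → Cn G V₂ y v := by
            intro v hv
            refine (hv.closed (K := V₂) ?_ (Cn.refl _ hc₂.left_mem)).2.mono (fun _ h => h.2)
            intro s t hs ha ht
            exact Cn.trans hs (Cn.head _ _ _ hs.right_mem ha (Cn.refl _ ht))
          rcases hu with hu | hu
          · refine psi_use hw h1 hx.1 hy.1 (S := V₂ᶜ) (T := V₂) (w := z)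
              (Cn.trans ((e1 u hu).mono fun v h h' => hV v h h') (h.symm.mono ?_))
              (e2 _ hc₂) hb₂ (fun z h h' => h h')
            rintro v (⟨_, hv⟩ | hv)
            · exact fun h => hv (Or.inr h)
            · simp at hv; subst hv; exact fun h => hV _ hu h
          · refine psi_use hw h2 hy.1 hx.1 (S := V₁ᶜ) (T := V₁) (w := z)
              (Cn.trans ((e2 u hu).mono fun v h h' => hV v h' h) (h.symm.mono ?_))
              (e1 _ hc₁) hb₁ (fun z h h' => h h')
            rintro v (⟨_, hv⟩ | hv)
            · exact fun h => hv (Or.inl h)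
            · simp at hv; subst hv; exact fun h => hV _ h hu

/-- component of `v` in `G - p` -/
def cmp (G : DGr) (p v : ℕ) : Set ℕ := {u | Cn G {p}ᶜ v u}

theorem cmp_closed {G : DGr} {p v s t : ℕ} (hs : s ∈ G.cmp p v) (ha : G.adj s t)
    (ht : t ∉ G.cmp p v) : t = p := by
  by_contra h
  exact ht (Cn.trans hs (Cn.head _ _ _ hs.right_mem ha (Cn.refl _ h)))

theorem cmp_conn {G : DGr} {p v u : ℕ} (hu : u ∈ G.cmp p v) : Cn G (G.cmp p v) v u := by
  refine (Cn.closed (K := G.cmp p v) ?_ hu (Cn.refl _ hu.left_mem)).2.mono (fun _ h => h.2)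
  intro s t hs ha ht
  exact Cn.trans hs (Cn.head _ _ _ hs.right_mem ha (Cn.refl _ ht))

theorem cmp_to_p_aux {G : DGr} {S : Set ℕ} {u p v : ℕ} (h : Cn G S u p)
    (hu : u ∈ G.cmp p v) : Cn G (insert p (G.cmp p v)) u p := by
  induction h with
  | refl u h => exact absurd rfl hu.right_mem
  | head u u' p hS ha h ih =>
    by_cases h' : u' = p
    · subst h'
      exact Cn.head _ _ _ (Or.inr hu) ha (Cn.refl _ (Or.inl rfl))
    · exact Cn.head _ _ _ (Or.inr hu) ha
        (ih (Cn.trans hu (Cn.head _ _ _ hu.right_mem ha (Cn.refl _ h'))))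

theorem cmp_to_p {G : DGr} (hc : G.WeaklyConnected) {p v w : ℕ} (hv : v ∈ G.V) (hw : w ∈ G.V)
    (hvp : v ≠ p) (h : w ∉ G.cmp p v) :
    Cn G (insert p (G.cmp p v)) v p := by
  rcases (hc.cn hv hw).first {p} with h' | ⟨z, hz, h'⟩
  · exact absurd (h'.mono (by intro z hz; exact hz.2)) h
  · simp at hz; subst hz
    exact cmp_to_p_aux h' (Cn.refl _ hvp)

theorem cmp_V {G : DGr} (hw : G.WellFormed) {p v u : ℕ} (hv : v ∈ G.V) (h : u ∈ G.cmp p v) :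
    u ∈ G.V := by
  refine (Cn.closed (K := ↑G.V) ?_ h hv).1
  intro s t _ ha _
  exact adj_mem hw ha

/-- the separating interval -/
theorem lemInt {G : DGr} (hw : G.WellFormed) (hf : G.WEFunctional) (hc : G.WeaklyConnected)
    {w : ℕ} (hwW : G.XVertex true w) {L : List ℕ} (hL : G.IsListOfX false L)
    (hg : G.GroundedIn false L) {a x b : ℕ} (hb : BtwL L a x b) (h2 : G.psi false x a b) :
    ∃ K p, G.Sep K p ∧ x ∈ K ∧ a ∈ K ∧ b ∉ K ∧ Cvx L K := by
  have hb' := (BtwL_iff hL.1).1 hb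
  obtain ⟨haL, hxL, hbL, hlt⟩ := hb'
  have hV : ∀ {z}, z ∈ L → z ∈ G.V := fun h => ((hL.2 _).1 h).1
  obtain ⟨p, hpa, hpx, hp⟩ := lemT hw hf hc ((hL.2 _).1 haL) ((hL.2 _).1 hxL) ((hL.2 _).1 hbL)
    (by rintro rfl; omega) (by rintro rfl; omega) (by rintro rfl; omega) (hg a x b hb) h2
  have hpa : a ≠ p := hpa.symm
  have hpx : x ≠ p := hpx.symm
  -- the elements between a and x
  let I : ℕ → Prop := fun t => t = a ∨ t = x ∨ (BtwL L a t x ∧ t ≠ p)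
  have hIL : ∀ t, I t → t ∈ L := by
    rintro t (rfl | rfl | ⟨h, _⟩)
    · exact haL
    · exact hxL
    · exact ((BtwL_iff hL.1).1 h).2.1
  have hIp : ∀ t, I t → t ≠ p := by
    rintro t (rfl | rfl | ⟨_, h⟩) <;> assumption
  have hcsymm : ∀ s t, s ∈ G.cmp p t → t ∈ G.cmp p s := fun s t h => Cn.symm h
  have hctrans : ∀ s t u, s ∈ G.cmp p t → t ∈ G.cmp p u → s ∈ G.cmp p u :=
    fun s t u h h' => Cn.trans h' h
  have hIW : ∀ t, I t → ∀ v, G.XVertex true v → v ∉ G.cmp p t := by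
    rintro t (rfl | rfl | ⟨h, htp⟩) v hv hvt
    · exact (hp v (Or.inr hv)).1 hvt
    · exact (hp v (Or.inr hv)).2 hvt
    · have hta : ∀ s, s ∈ G.cmp p t → s ∉ G.cmp p a := fun s hs hs' =>
        (hp v (Or.inr hv)).1 (hctrans _ _ _ hvt (hctrans _ _ _ (hcsymm _ _ hs) hs'))
      have htx : ∀ s, s ∈ G.cmp p t → s ∉ G.cmp p x := fun s hs hs' =>
        (hp v (Or.inr hv)).2 (hctrans _ _ _ hvt (hctrans _ _ _ (hcsymm _ _ hs) hs'))
      have k1 := cmp_to_p hc (hV haL) hv.1 hpa (hp v (Or.inr hv)).1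
      have k2 := cmp_to_p hc (hV hxL) hv.1 hpx (hp v (Or.inr hv)).2
      refine psi_use hw (hg a t x h) (hV haL) (hV (((BtwL_iff hL.1).1 h).2.1))
        (S := insert p (G.cmp p a ∪ G.cmp p x)) (T := G.cmp p t)
        (Cn.trans (k1.mono ?_) (k2.symm.mono ?_)) (cmp_conn hvt) hv ?_
      · rintro z (h | h)
        · exact Or.inl h
        · exact Or.inr (Or.inl h)
      · rintro z (h | h)
        · exact Or.inl h
        · exact Or.inr (Or.inr h)
      · rintro z (rfl | h | h) hz
        · exact absurd rfl hz.right_mem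
        · exact hta z hz h
        · exact htx z hz h
  have hav : ∀ t u, I t → u ∈ G.V → u ∉ G.cmp p t → Cn G (G.cmp p t)ᶜ u w := by
    intro t u ht hu hut
    refine ((hc.cn hu hwW.1).avoid (K := G.cmp p t) (p := p) (fun h => absurd rfl h.right_mem)
      ?_ (hIW t ht w hwW)).1 hut
    intro s t' hs ha ht
    exact cmp_closed hs ha ht
  have hIb : ∀ t, I t → b ∉ G.cmp p t := by
    rintro t (rfl | rfl | ⟨h, htp⟩) hbt
    · exact (hp b (Or.inl rfl)).1 hbt
    · exact (hp b (Or.inl rfl)).2 hbt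
    · have hxt : x ∉ G.cmp p t := fun h =>
        (hp b (Or.inl rfl)).2 (hctrans _ _ _ hbt (hcsymm _ _ h))
      have h' := (BtwL_iff hL.1).1 h
      have htxb : BtwL L t x b := (BtwL_iff hL.1).2 ⟨h'.2.1, hxL, hbL, by omega⟩
      exact psi_use hw (hg t x b htxb) (hV h'.2.1) (hV hxL) (cmp_conn hbt)
        (hav t x (Or.inr (Or.inr ⟨h, htp⟩)) (hV hxL) hxt) hwW (fun z h h' => h' h)
  refine ⟨{v | ∃ t, I t ∧ v ∈ G.cmp p t}, p, ⟨?_, ?_, ?_, ?_⟩, ?_, ?_, ?_, ?_⟩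
  · rintro z ⟨t, ht, hz⟩
    exact cmp_V hw (hV (hIL t ht)) hz
  · rintro ⟨t, ht, hz⟩
    exact absurd rfl hz.right_mem
  · rintro s t ⟨t', ht', hs⟩ ha ht
    exact cmp_closed hs ha (fun h => ht ⟨t', ht', h⟩)
  · rintro v hv ⟨t, ht, hz⟩
    exact hIW t ht v hv hz
  · exact ⟨x, Or.inr (Or.inl rfl), Cn.refl _ hpx⟩
  · exact ⟨a, Or.inl rfl, Cn.refl _ hpa⟩
  · rintro ⟨t, ht, hz⟩
    exact hIb t ht hz
  · rintro s u s' hbt ⟨t, ht, hs⟩ ⟨t', ht', hs'⟩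
    by_contra hu
    have hbt' := (BtwL_iff hL.1).1 hbt
    have huL := hbt'.2.1
    -- no element of K-component pair can surround u
    have A1 : ∀ t, I t → ∀ s, s ∈ L → s ∈ G.cmp p t → ¬ BtwL L t u s := by
      intro t ht s _ hs h
      exact psi_use hw (hg t u s h) (hV (hIL t ht)) (hV huL) (cmp_conn hs)
        (hav t u ht (hV huL) (fun h => hu ⟨t, ht, h⟩)) hwW (fun z h h' => h' h)
    have htu : ∀ t, I t → L.idxOf t ≠ L.idxOf u := by
      intro t ht h
      have := (List.idxOf_inj (hIL t ht)).1 h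
      subst this
      exact hu ⟨t, ht, Cn.refl _ (hIp t ht)⟩
    have a1 := A1 t ht s hbt'.1 hs
    have a2 := A1 t' ht' s' hbt'.2.2.1 hs'
    rw [BtwL_iff hL.1] at a1 a2
    have a1 : ¬ _ := fun h => a1 ⟨hIL t ht, huL, hbt'.1, h⟩
    have a2 : ¬ _ := fun h => a2 ⟨hIL t' ht', huL, hbt'.2.2.1, h⟩
    have n1 := htu t ht
    have n2 := htu t' ht'
    have hI2 : ∀ t, I t → (L.idxOf a ≤ L.idxOf t ∧ L.idxOf t ≤ L.idxOf x) ∨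
        (L.idxOf x ≤ L.idxOf t ∧ L.idxOf t ≤ L.idxOf a) := by
      rintro t (rfl | rfl | ⟨h, _⟩)
      · omega
      · omega
      · have := ((BtwL_iff hL.1).1 h).2.2.2; omega
    have m1 := hI2 t ht
    have m2 := hI2 t' ht'
    have n3 := htu a (Or.inl rfl)
    have n4 := htu x (Or.inr (Or.inl rfl))
    have hbtw : BtwL L a u x := (BtwL_iff hL.1).2 ⟨haL, huL, hxL, by omega⟩
    by_cases hup : u = p
    · subst hup
      exact (hp b (Or.inl rfl)).1 (leaf_avoid hf hc ((hL.2 _).1 huL) (hV haL) (hV hbL) hpa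
        (by rintro rfl; have := (BtwL_iff hL.1).1 hbtw; omega))
    · exact hu ⟨u, Or.inr (Or.inr ⟨hbtw, hup⟩), Cn.refl _ hup⟩

end DGr

/- ===== Part 4: junctures, constructions, reversals ===== -/
namespace DGr

theorem junc_W {GW GE : DGr} {a : ℕ} (ha : a ∈ GW.A) : (GW.junc GE).W a = GW.W a := by
  simp [junc, ha]
theorem junc_W' {GW GE : DGr} {a : ℕ} (ha : a ∉ GW.A) (h : a ∈ GE.A) :
    (GW.junc GE).W a = GE.W a := by
  simp [junc, ha, h]
theorem junc_E {GW GE : DGr} {a : ℕ} (ha : a ∈ GE.A) : (GW.junc GE).E a = GE.E a := by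
  simp [junc, ha]
theorem junc_E' {GW GE : DGr} {a : ℕ} (ha : a ∉ GE.A) (h : a ∈ GW.A) :
    (GW.junc GE).E a = GW.E a := by
  simp [junc, ha, h]
theorem junc_A {GW GE : DGr} {a : ℕ} : a ∈ (GW.junc GE).A ↔ a ∈ GW.A ∨ a ∈ GE.A := by
  simp [junc]

namespace JuncDefined
variable {GW GE : DGr} (h : GW.JuncDefined GE)
include h

theorem common {z : ℕ} : (z ∈ GW.V ∧ z ∈ GE.V) ↔ ∃ c, c ∈ GW.A ∧ c ∈ GE.A ∧ GW.E c = z := by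
  have h5 := h.2.2.2.2
  rw [← Finset.mem_inter, h5]
  simp [and_assoc]

theorem memV {z : ℕ} : z ∈ (GW.junc GE).V ↔ (z ∈ GW.V ∧ z ∉ GE.V) ∨ (z ∈ GE.V ∧ z ∉ GW.V) := by
  have h5 := h.2.2.2.2
  simp only [junc, ← h5, Finset.mem_sdiff, Finset.mem_union, Finset.mem_inter]
  tauto

theorem cE {c : ℕ} (h1 : c ∈ GW.A) (h2 : c ∈ GE.A) : GW.E c = GE.W c :=
  (h.2.2.2.1 c (Finset.mem_inter.2 ⟨h1, h2⟩)).1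
theorem cXW {c : ℕ} (h1 : c ∈ GW.A) (h2 : c ∈ GE.A) : GW.XEdge false c :=
  (h.2.2.2.1 c (Finset.mem_inter.2 ⟨h1, h2⟩)).2.1
theorem cXE {c : ℕ} (h1 : c ∈ GW.A) (h2 : c ∈ GE.A) : GE.XEdge true c :=
  (h.2.2.2.1 c (Finset.mem_inter.2 ⟨h1, h2⟩)).2.2

theorem comW {z : ℕ} (h1 : z ∈ GW.V) (h2 : z ∈ GE.V) : GW.XVertex false z := by
  obtain ⟨c, hc, hc', rfl⟩ := h.common.1 ⟨h1, h2⟩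
  exact (h.cXW hc hc').2
theorem comE {z : ℕ} (h1 : z ∈ GW.V) (h2 : z ∈ GE.V) : GE.XVertex true z := by
  obtain ⟨c, hc, hc', rfl⟩ := h.common.1 ⟨h1, h2⟩
  rw [h.cE hc hc']
  exact (h.cXE hc hc').2

theorem WW {a : ℕ} (ha : a ∈ GW.A) : GW.W a ∈ GW.V ∧ GW.W a ∉ GE.V := by
  have h1 := (h.1.1 a ha).1
  exact ⟨h1, fun h2 => (h.comW h1 h2).2 a ha rfl⟩
theorem EE {a : ℕ} (ha : a ∈ GE.A) : GE.E a ∈ GE.V ∧ GE.E a ∉ GW.V := by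
  have h1 := (h.2.1.1 a ha).2
  exact ⟨h1, fun h2 => (h.comE h2 h1).2 a ha rfl⟩
theorem WE {a : ℕ} (ha : a ∈ GW.A) (ha' : a ∉ GE.A) : GW.E a ∈ GW.V ∧ GW.E a ∉ GE.V := by
  have h1 := (h.1.1 a ha).2
  refine ⟨h1, fun h2 => ?_⟩
  obtain ⟨c, hc, hc', h3⟩ := h.common.1 ⟨h1, h2⟩
  have hac : a ≠ c := by rintro rfl; exact ha' hc'
  exact h.1.2.2.1 false c (h.cXW hc hc') a ha hac h3.symm
theorem EW {a : ℕ} (ha : a ∈ GE.A) (ha' : a ∉ GW.A) : GE.W a ∈ GE.V ∧ GE.W a ∉ GW.V := by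
  have h1 := (h.2.1.1 a ha).1
  refine ⟨h1, fun h2 => ?_⟩
  obtain ⟨c, hc, hc', h3⟩ := h.common.1 ⟨h2, h1⟩
  have hac : a ≠ c := by rintro rfl; exact ha' hc
  rw [h.cE hc hc'] at h3
  exact h.2.1.2.2.1 true c (h.cXE hc hc') a ha hac h3.symm
theorem CC {c : ℕ} (h1 : c ∈ GW.A) (h2 : c ∈ GE.A) : GW.E c ∈ GW.V ∧ GW.E c ∈ GE.V :=
  h.common.2 ⟨c, h1, h2, rfl⟩

theorem xv_true {z : ℕ} : (GW.junc GE).XVertex true z ↔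
    GW.XVertex true z ∨ (GE.XVertex true z ∧ z ∉ GW.V) := by
  constructor
  · rintro ⟨h1, h2⟩
    have h2 : ∀ a ∈ (GW.junc GE).A, (GW.junc GE).E a ≠ z := h2
    rcases h.memV.1 h1 with ⟨h3, h4⟩ | ⟨h3, h4⟩
    · refine Or.inl ⟨h3, ?_⟩
      intro a ha
      change GW.E a ≠ z
      by_cases ha' : a ∈ GE.A
      · rintro rfl; exact h4 (h.CC ha ha').2
      · have := h2 a (junc_A.2 (Or.inl ha))
        rwa [junc_E' ha' ha] at this
    · refine Or.inr ⟨⟨h3, ?_⟩, h4⟩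
      intro a ha
      change GE.E a ≠ z
      have := h2 a (junc_A.2 (Or.inr ha))
      rwa [junc_E ha] at this
  · rintro (h1 | ⟨h1, h2⟩)
    · have h3 : z ∉ GE.V := by
        intro h3
        obtain ⟨c, hc, hc', rfl⟩ := h.common.1 ⟨h1.1, h3⟩
        exact h1.2 c hc rfl
      refine ⟨h.memV.2 (Or.inl ⟨h1.1, h3⟩), ?_⟩
      intro a ha
      change (GW.junc GE).E a ≠ z
      by_cases ha' : a ∈ GE.A
      · rw [junc_E ha']; rintro rfl; exact h3 (h.EE ha').1
      · have ha2 : a ∈ GW.A := (junc_A.1 ha).resolve_right ha'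
        rw [junc_E' ha' ha2]; exact h1.2 a ha2
    · refine ⟨h.memV.2 (Or.inr ⟨h1.1, h2⟩), ?_⟩
      intro a ha
      change (GW.junc GE).E a ≠ z
      by_cases ha' : a ∈ GE.A
      · rw [junc_E ha']; exact h1.2 a ha'
      · have ha2 : a ∈ GW.A := (junc_A.1 ha).resolve_right ha'
        rw [junc_E' ha' ha2]; rintro rfl; exact h2 (h.WE ha2 ha').1

theorem xv_false {z : ℕ} : (GW.junc GE).XVertex false z ↔
    GE.XVertex false z ∨ (GW.XVertex false z ∧ z ∉ GE.V) := by
  constructor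
  · rintro ⟨h1, h2⟩
    have h2 : ∀ a ∈ (GW.junc GE).A, (GW.junc GE).W a ≠ z := h2
    rcases h.memV.1 h1 with ⟨h3, h4⟩ | ⟨h3, h4⟩
    · refine Or.inr ⟨⟨h3, ?_⟩, h4⟩
      intro a ha
      change GW.W a ≠ z
      have := h2 a (junc_A.2 (Or.inl ha))
      rwa [junc_W ha] at this
    · refine Or.inl ⟨h3, ?_⟩
      intro a ha
      change GE.W a ≠ z
      by_cases ha' : a ∈ GW.A
      · rintro rfl; rw [← h.cE ha' ha] at h4; exact h4 (h.CC ha' ha).1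
      · have := h2 a (junc_A.2 (Or.inr ha))
        rwa [junc_W' ha' ha] at this
  · rintro (h1 | ⟨h1, h2⟩)
    · have h3 : z ∉ GW.V := by
        intro h3
        obtain ⟨c, hc, hc', rfl⟩ := h.common.1 ⟨h3, h1.1⟩
        exact h1.2 c hc' (h.cE hc hc').symm
      refine ⟨h.memV.2 (Or.inr ⟨h1.1, h3⟩), ?_⟩
      intro a ha
      change (GW.junc GE).W a ≠ z
      by_cases ha' : a ∈ GW.A
      · rw [junc_W ha']; rintro rfl; exact h3 (h.WW ha').1
      · have ha2 : a ∈ GE.A := (junc_A.1 ha).resolve_left ha'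
        rw [junc_W' ha' ha2]; exact h1.2 a ha2
    · refine ⟨h.memV.2 (Or.inl ⟨h1.1, h2⟩), ?_⟩
      intro a ha
      change (GW.junc GE).W a ≠ z
      by_cases ha' : a ∈ GW.A
      · rw [junc_W ha']; exact h1.2 a ha'
      · have ha2 : a ∈ GE.A := (junc_A.1 ha).resolve_left ha'
        rw [junc_W' ha' ha2]; rintro rfl; exact h2 (h.EW ha2 ha').1

end JuncDefined

theorem no_loop {G : DGr} (h : G.Acyclic) (hw : G.WellFormed) {a : ℕ} (ha : a ∈ G.A) :
    G.W a ≠ G.E a := by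
  intro he
  refine h [G.W a, G.W a] [a] ⟨⟨by simp, ?_, by simpa using ha, ?_⟩, by simp, by simp, by simp⟩
  · intro v hv; simp at hv; subst hv; exact (hw a ha).1
  · intro i b u v hb hu hv
    cases i with
    | zero => simp at hb hu hv; subst hb hu hv; exact ⟨rfl, he.symm⟩
    | succ i => simp at hb

/-- connectivity after cutting off leaves -/
theorem conn_cut {G : DGr} (hG : G.IsDGraph) (X : Bool) (C : ℕ → Prop) (T : Set ℕ)
    (hC : ∀ c, C c → G.XEdge X c)
    (hT : ∀ a ∈ G.A, ¬ C a → (G.W a ∈ T ↔ G.E a ∈ T)) {u v : ℕ} (hu : u ∈ G.V) (hv : v ∈ G.V)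
    (hu' : ∀ c, C c → G.Xf X c ≠ u) (hv' : ∀ c, C c → G.Xf X c ≠ v) (huT : u ∈ T) : v ∈ T := by
  have hT' : ∀ a ∈ G.A, ¬ C a → (G.Xf X a ∈ T ↔ G.Xf (!X) a ∈ T) := by
    intro a ha hc
    cases X
    · exact (hT a ha hc).symm
    · exact hT a ha hc
  have key := conn_closed hG.2.2.2.1
    (T := {v | (v ∈ T ∧ ∀ c, C c → G.Xf X c ≠ v) ∨ ∃ c, C c ∧ G.Xf X c = v ∧ G.Xf (!X) c ∈ T})
    ?_ hu hv (Or.inl ⟨huT, hu'⟩)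
  · rcases key with h | ⟨c, hc, h, _⟩
    · exact h.1
    · exact absurd h (hv' c hc)
  · intro a ha
    have main : (G.Xf X a ∈ {v | (v ∈ T ∧ ∀ c, C c → G.Xf X c ≠ v) ∨
        ∃ c, C c ∧ G.Xf X c = v ∧ G.Xf (!X) c ∈ T}) ↔
      (G.Xf (!X) a ∈ {v | (v ∈ T ∧ ∀ c, C c → G.Xf X c ≠ v) ∨
        ∃ c, C c ∧ G.Xf X c = v ∧ G.Xf (!X) c ∈ T}) := by
      have n1 : ∀ c, C c → G.Xf X c ≠ G.Xf (!X) a := fun c hc h => (hC c hc).2.2 a ha h.symm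
      have inj : ∀ c, C c → G.Xf X c = G.Xf X a → c = a := by
        intro c hc h
        by_contra hne
        exact hG.2.2.1 X c (hC c hc) a ha (Ne.symm hne) h.symm
      simp only [Set.mem_setOf_eq]
      by_cases hCa : C a
      · constructor
        · rintro (⟨_, h⟩ | ⟨c, hc, h1, h2⟩)
          · exact absurd rfl (h a hCa)
          · rw [inj c hc h1] at h2; exact Or.inl ⟨h2, n1⟩
        · rintro (⟨h, _⟩ | ⟨c, hc, h1, h2⟩)
          · exact Or.inr ⟨a, hCa, rfl, h⟩
          · exact absurd h1 (n1 c hc)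
      · constructor
        · rintro (⟨h, _⟩ | ⟨c, hc, h1, h2⟩)
          · exact Or.inl ⟨(hT' a ha hCa).1 h, n1⟩
          · exact absurd (inj c hc h1 ▸ hc) hCa
        · rintro (⟨h, _⟩ | ⟨c, hc, h1, h2⟩)
          · exact Or.inl ⟨(hT' a ha hCa).2 h, fun c hc h => hCa (inj c hc h ▸ hc)⟩
          · exact absurd h1 (n1 c hc)
    cases X
    · exact main.symm
    · exact main

theorem basic_X {G : DGr} (h : G.IsBasicDGraph) (X : Bool) : ∃ v, G.XVertex X v := by
  obtain ⟨hG, v, hv, huniq⟩ := h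
  by_contra hno
  have hno : ∀ u, ¬ G.XVertex X u := fun u hu => hno ⟨u, hu⟩
  have h1 := hno v
  have : ∃ a ∈ G.A, G.Xf (!X) a = v := by
    by_contra h2
    exact h1 ⟨hv.1, fun a ha h => h2 ⟨a, ha, h⟩⟩
  obtain ⟨a, ha, hav⟩ := this
  have hloop := no_loop hG.2.1 hG.1 ha
  cases X
  · have hE : G.InnerVertex (G.E a) := ⟨(hG.1 a ha).2, fun h => h.2 a ha rfl, hno _⟩
    exact hloop (hav.trans (huniq _ hE).symm)
  · have hE : G.InnerVertex (G.W a) := ⟨(hG.1 a ha).1, hno _, fun h => h.2 a ha rfl⟩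
    exact hloop ((huniq _ hE).trans hav.symm)

end DGr

open DGr

theorem Construction.lists {D : DGr} {LW LE : List ℕ} (h : Construction D LW LE) :
    D.IsListOfX true LW ∧ D.IsListOfX false LE ∧ LW ≠ [] ∧ LE ≠ [] := by
  induction h with
  | basic G LW LE hG h1 h2 =>
    refine ⟨h1, h2, ?_, ?_⟩
    · rintro rfl
      obtain ⟨v, hv⟩ := basic_X hG true
      simpa using (h1.2 v).2 hv
    · rintro rfl
      obtain ⟨v, hv⟩ := basic_X hG false
      simpa using (h2.2 v).2 hv
  | box GW GE LWW LEE Φe Ξ Ψe Φw Ψw c1 c2 hJ hΞ hΦ hΨ d1 d2 d3 d4 d5 d6 d7 d8 d9 d10 ih1 ih2 =>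
    obtain ⟨⟨n1, m1⟩, ⟨n2, m2⟩, e1, e1'⟩ := ih1
    obtain ⟨⟨n3, m3⟩, ⟨n4, m4⟩, e2, e2'⟩ := ih2
    have k1 : ∀ z, z ∈ Φw ++ Ξ ++ Ψw → z ∈ GE.V := fun z hz => ((m3 z).1 hz).1
    have k2 : ∀ z, z ∈ Φe ++ Ξ ++ Ψe → z ∈ GW.V := fun z hz => ((m2 z).1 hz).1
    have k3 : ∀ z, z ∈ Φw ∨ z ∈ Ψw → z ∉ GW.V := by
      intro z hz hz'
      have hz1 := (m2 z).2 (hJ.comW hz' (k1 z (by simp; tauto)))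
      simp only [List.mem_append] at hz1
      rcases hz with hz | hz <;> rcases hz1 with (hz1 | hz1) | hz1
      · exact d7 hz1 hz
      · exact d4 hz hz1
      · exact d9 hz1 hz
      · exact d8 hz1 hz
      · exact d6 hz1 hz
      · exact d10 hz1 hz
    have k4 : ∀ z, z ∈ Φe ∨ z ∈ Ψe → z ∉ GE.V := by
      intro z hz hz'
      have hz1 := (m3 z).2 (hJ.comE (k2 z (by simp; tauto)) hz')
      simp only [List.mem_append] at hz1
      rcases hz with hz | hz <;> rcases hz1 with (hz1 | hz1) | hz1
      · exact d7 hz hz1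
      · exact d1 hz hz1
      · exact d8 hz hz1
      · exact d9 hz hz1
      · exact d3 hz1 hz
      · exact d10 hz hz1
    have k5 : ∀ z ∈ LWW, z ∈ GW.V := fun z hz => ((m1 z).1 hz).1
    have k6 : ∀ z ∈ LEE, z ∈ GE.V := fun z hz => ((m4 z).1 hz).1
    refine ⟨⟨?_, ?_⟩, ⟨?_, ?_⟩, by simp [e1], by simp [e2']⟩
    · simp only [List.nodup_append, List.mem_append] at n3 ⊢
      refine ⟨⟨n3.1.1, n1, ?_⟩, n3.2.1, ?_⟩
      · rintro a ha b hb rfl; exact k3 a (Or.inl ha) (k5 a hb)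
      · rintro a (ha | ha) b hb rfl
        · exact d5 ha hb
        · exact k3 a (Or.inr hb) (k5 a ha)
    · intro z
      rw [hJ.xv_true, ← m1, ← m3]
      simp only [List.mem_append]
      constructor
      · rintro ((h | h) | h)
        · exact Or.inr ⟨by tauto, k3 z (Or.inl h)⟩
        · exact Or.inl h
        · exact Or.inr ⟨by tauto, k3 z (Or.inr h)⟩
      · rintro (h | ⟨(h | h) | h, h'⟩)
        · tauto
        · tauto
        · exact absurd (k2 z (by simp [h])) h'
        · tauto
    · simp only [List.nodup_append, List.mem_append] at n2 ⊢
      refine ⟨⟨n2.1.1, n4, ?_⟩, n2.2.1, ?_⟩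
      · rintro a ha b hb rfl; exact k4 a (Or.inl ha) (k6 a hb)
      · rintro a (ha | ha) b hb rfl
        · exact d2 ha hb
        · exact k4 a (Or.inr hb) (k6 a ha)
    · intro z
      rw [hJ.xv_false, ← m4, ← m2]
      simp only [List.mem_append]
      constructor
      · rintro ((h | h) | h)
        · exact Or.inr ⟨by tauto, k4 z (Or.inl h)⟩
        · exact Or.inl h
        · exact Or.inr ⟨by tauto, k4 z (Or.inr h)⟩
      · rintro (h | ⟨(h | h) | h, h'⟩)
        · tauto
        · tauto
        · exact absurd (k1 z (by simp [h])) h'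
        · tauto

theorem isList_perm {G : DGr} {X : Bool} {L L' : List ℕ} (h : G.IsListOfX X L) (hp : L.Perm L') :
    G.IsListOfX X L' :=
  ⟨hp.nodup_iff.1 h.1, fun v => by rw [← hp.mem_iff]; exact h.2 v⟩

theorem Construction.rev {D : DGr} {LW LE : List ℕ} (h : Construction D LW LE) :
    Construction D LW.reverse LE.reverse := by
  induction h with
  | basic G LW LE hG h1 h2 =>
    exact .basic G _ _ hG (isList_perm h1 (List.reverse_perm _).symm)
      (isList_perm h2 (List.reverse_perm _).symm)
  | box GW GE LWW LEE Φe Ξ Ψe Φw Ψw c1 c2 hJ hΞ hΦ hΨ d1 d2 d3 d4 d5 d6 d7 d8 d9 d10 ih1 ih2 =>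
    have := Construction.box GW GE LWW.reverse LEE.reverse Ψe.reverse Ξ.reverse Φe.reverse
      Ψw.reverse Φw.reverse (by simpa using ih1) (by simpa using ih2) hJ (by simpa using hΞ)
      (by simpa using hΨ) (by simpa using hΦ)
    simp only [List.reverse_append, List.append_assoc] at this ⊢
    refine this ?_ ?_ ?_ ?_ ?_ ?_ ?_ ?_ ?_ ?_ <;>
      (intro z hz hz'; simp only [List.mem_reverse] at hz hz')
    · exact d3 hz' hz
    · exact d2 hz' hz
    · exact d1 hz' hz
    · exact d6 hz' hz
    · exact d5 hz' hz
    · exact d4 hz' hz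
    · exact d10 hz hz'
    · exact d9 hz hz'
    · exact d8 hz hz'
    · exact d7 hz hz'

/- ===== Part 5: reversing a separated segment ===== -/
open DGr

theorem Construction.box' {GW GE : DGr} {LWW LEE Φe Ξ Ψe Φw Ψw : List ℕ}
    (c1 : Construction GW LWW (Φe ++ Ξ ++ Ψe)) (c2 : Construction GE (Φw ++ Ξ ++ Ψw) LEE)
    (hJ : GW.JuncDefined GE) (hΞ : Ξ ≠ []) (h1 : Φe = [] ∨ Φw = []) (h2 : Ψe = [] ∨ Ψw = [])
    (he : ∀ z, z ∈ Φe ∨ z ∈ Ψe → z ∉ GE.V) :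
    Construction (GW.junc GE) (Φw ++ LWW ++ Ψw) (Φe ++ LEE ++ Ψe) := by
  have n1 := c1.lists.2.1.1
  have n2 := c2.lists.1.1
  have k2 : ∀ z, z ∈ Φw ++ Ξ ++ Ψw → z ∈ GE.V := fun z hz => ((c2.lists.1.2 z).1 hz).1
  simp only [List.nodup_append, List.mem_append] at n1 n2 k2
  refine .box GW GE LWW LEE Φe Ξ Ψe Φw Ψw c1 c2 hJ hΞ h1 h2 ?_ ?_ ?_ ?_ ?_ ?_ ?_ ?_ ?_ ?_ <;>
    intro z hz hz'
  · exact n1.1.2.2 z hz z hz' rfl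
  · exact n1.2.2 z (Or.inl hz) z hz' rfl
  · exact n1.2.2 z (Or.inr hz) z hz' rfl
  · exact n2.1.2.2 z hz z hz' rfl
  · exact n2.2.2 z (Or.inl hz) z hz' rfl
  · exact n2.2.2 z (Or.inr hz) z hz' rfl
  all_goals exact he z (by tauto) (k2 z (by tauto))

theorem Construction.ind' {motive : DGr → List ℕ → List ℕ → Prop}
    (hb : ∀ G LW LE, G.IsBasicDGraph → G.IsListOfX true LW → G.IsListOfX false LE → motive G LW LE)
    (hbox : ∀ (GW GE : DGr) (LWW LEE Φe Ξ Ψe Φw Ψw : List ℕ),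
      Construction GW LWW (Φe ++ Ξ ++ Ψe) → Construction GE (Φw ++ Ξ ++ Ψw) LEE →
      GW.JuncDefined GE → Ξ ≠ [] → (Φe = [] ∨ Φw = []) → (Ψe = [] ∨ Ψw = []) →
      (∀ z, z ∈ Φe ∨ z ∈ Ψe → z ∈ GW.V ∧ z ∉ GE.V) →
      (∀ z, z ∈ Φw ∨ z ∈ Ψw → z ∈ GE.V ∧ z ∉ GW.V) →
      (∀ z, z ∈ Ξ ↔ z ∈ GW.V ∧ z ∈ GE.V) →
      motive GW LWW (Φe ++ Ξ ++ Ψe) → motive GE (Φw ++ Ξ ++ Ψw) LEE →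
      motive (GW.junc GE) (Φw ++ LWW ++ Ψw) (Φe ++ LEE ++ Ψe))
    {D : DGr} {LW LE : List ℕ} (h : Construction D LW LE) : motive D LW LE := by
  induction h with
  | basic G LW LE hG h1 h2 => exact hb G LW LE hG h1 h2
  | box GW GE LWW LEE Φe Ξ Ψe Φw Ψw c1 c2 hJ hΞ hΦ hΨ d1 d2 d3 d4 d5 d6 d7 d8 d9 d10 ih1 ih2 =>
    have m2 := c1.lists.2.1.2
    have m3 := c2.lists.1.2
    have k1 : ∀ z, z ∈ Φw ++ Ξ ++ Ψw → z ∈ GE.V := fun z hz => ((m3 z).1 hz).1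
    have k2 : ∀ z, z ∈ Φe ++ Ξ ++ Ψe → z ∈ GW.V := fun z hz => ((m2 z).1 hz).1
    have k3 : ∀ z, z ∈ Φw ∨ z ∈ Ψw → z ∉ GW.V := by
      intro z hz hz'
      have hz1 := (m2 z).2 (hJ.comW hz' (k1 z (by simp; tauto)))
      simp only [List.mem_append] at hz1
      rcases hz with hz | hz <;> rcases hz1 with (hz1 | hz1) | hz1
      · exact d7 hz1 hz
      · exact d4 hz hz1
      · exact d9 hz1 hz
      · exact d8 hz1 hz
      · exact d6 hz1 hz
      · exact d10 hz1 hz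
    have k4 : ∀ z, z ∈ Φe ∨ z ∈ Ψe → z ∉ GE.V := by
      intro z hz hz'
      have hz1 := (m3 z).2 (hJ.comE (k2 z (by simp; tauto)) hz')
      simp only [List.mem_append] at hz1
      rcases hz with hz | hz <;> rcases hz1 with (hz1 | hz1) | hz1
      · exact d7 hz hz1
      · exact d1 hz hz1
      · exact d8 hz hz1
      · exact d9 hz hz1
      · exact d3 hz1 hz
      · exact d10 hz hz1
    refine hbox GW GE LWW LEE Φe Ξ Ψe Φw Ψw c1 c2 hJ hΞ hΦ hΨ
      (fun z hz => ⟨k2 z (by simp; tauto), k4 z hz⟩) (fun z hz => ⟨k1 z (by simp; tauto), k3 z hz⟩)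
      (fun z => ⟨fun hz => ⟨k2 z (by simp [hz]), k1 z (by simp [hz])⟩, fun hz => ?_⟩) ih1 ih2
    have := (m2 z).2 (hJ.comW hz.1 hz.2)
    simp only [List.mem_append] at this
    rcases this with (h | h) | h
    · exact absurd hz.2 (k4 z (Or.inl h))
    · exact h
    · exact absurd hz.2 (k4 z (Or.inr h))

theorem LL0 {Φ M l1 s : List ℕ} {K : Set ℕ} (h : Φ ++ M = l1 ++ s)
    (hsK : ∀ z ∈ s, z ∈ K) (hΦ : ∀ z ∈ Φ, z ∉ K) : ∃ m, l1 = Φ ++ m ∧ M = m ++ s := by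
  rcases List.append_eq_append_iff.1 h with ⟨a, h1, h2⟩ | ⟨a, h1, h2⟩
  · exact ⟨a, h1, h2⟩
  · cases a with
    | nil => exact ⟨[], by simpa using h1.symm, by simpa using h2.symm⟩
    | cons x a =>
      exact absurd (hsK x (by simp [h2])) (hΦ x (by simp [h1]))

theorem LL1 {Φ M Ψ l1 s l2 : List ℕ} {K : Set ℕ} (h : Φ ++ M ++ Ψ = l1 ++ s ++ l2) (hs : s ≠ [])
    (hsK : ∀ z ∈ s, z ∈ K) (hΦ : ∀ z ∈ Φ, z ∉ K) (hΨ : ∀ z ∈ Ψ, z ∉ K) :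
    ∃ m1 m2, l1 = Φ ++ m1 ∧ l2 = m2 ++ Ψ ∧ M = m1 ++ s ++ m2 := by
  rcases List.append_eq_append_iff.1 h with ⟨a, h1, h2⟩ | ⟨a, h1, h2⟩
  · have ha : a = [] ∨ ∃ y b, a = b ++ [y] := by
      rcases List.eq_nil_or_concat a with h | ⟨b, y, h⟩
      · exact Or.inl h
      · exact Or.inr ⟨y, b, by simpa using h⟩
    rcases ha with rfl | ⟨y, b, rfl⟩
    · simp only [List.append_nil, List.nil_append] at h1 h2
      obtain ⟨m, hm1, hm2⟩ := LL0 h1.symm hsK hΦ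
      exact ⟨m, [], hm1, by simp [h2], by simp [hm2]⟩
    · exfalso
      rcases List.eq_nil_or_concat s with h | ⟨s', y', h⟩
      · exact hs h
      · subst h
        rw [List.concat_eq_append] at *
        rw [← List.append_assoc, ← List.append_assoc] at h1
        have := List.append_inj_right' h1 rfl
        simp only [List.cons.injEq, and_true] at this
        subst this
        exact hΨ y' (by simp [h2]) (hsK y' (by simp))
  · by_cases hsa : True
    · have h1' : Φ ++ M = l1 ++ (s ++ a) := by rw [h1, List.append_assoc]
      rcases List.append_eq_append_iff.1 h1' with ⟨b, h3, h4⟩ | ⟨b, h3, h4⟩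
      · exact ⟨b, a, h3, h2, by simp [h4]⟩
      · cases b with
        | nil => exact ⟨[], a, by simpa using h3.symm, h2, by simpa using h4.symm⟩
        | cons x b =>
          exfalso
          cases s with
          | nil => exact hs rfl
          | cons y s =>
            simp only [List.cons_append, List.cons.injEq] at h4
            obtain ⟨rfl, _⟩ := h4
            exact hΦ y (by simp [h3]) (hsK y (by simp))
    · exact absurd trivial hsa

theorem last_common {X b Y c : List ℕ} (h : X ++ b = Y ++ c) (hb : b ≠ []) (hc : c ≠ []) :
    ∃ z, z ∈ b ∧ z ∈ c := by
  rcases List.eq_nil_or_concat b with h1 | ⟨b', y, h1⟩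
  · exact absurd h1 hb
  rcases List.eq_nil_or_concat c with h2 | ⟨c', y', h2⟩
  · exact absurd h2 hc
  subst h1 h2
  rw [List.concat_eq_append, List.concat_eq_append, ← List.append_assoc, ← List.append_assoc] at h
  have := List.append_inj_right' h rfl
  simp only [List.cons.injEq, and_true] at this
  subst this
  exact ⟨y, by simp, by simp⟩

theorem LL2 {Φ M Ψ l1 s l2 : List ℕ} {K : Set ℕ} (h : Φ ++ M ++ Ψ = l1 ++ s ++ l2) (hs : s ≠ [])
    (hM : M ≠ []) (hsK : ∀ z ∈ s, z ∈ K) (hMK : ∀ z ∈ M, z ∉ K) :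
    (∃ m, Φ = l1 ++ s ++ m ∧ l2 = m ++ M ++ Ψ) ∨ (∃ m, Ψ = m ++ s ++ l2 ∧ l1 = Φ ++ M ++ m) := by
  rcases List.append_eq_append_iff.1 h with ⟨a, h1, h2⟩ | ⟨a, h1, h2⟩
  · refine Or.inr ?_
    rcases List.append_eq_append_iff.1 h1.symm with ⟨b, h3, h4⟩ | ⟨b, h3, h4⟩
    · exact ⟨b, by rw [h2, h4], h3⟩
    · by_cases hb : b = []
      · subst hb
        exact ⟨[], by simp [h2, h4], by simpa using h3.symm⟩
      · exfalso
        obtain ⟨z, hz, hz'⟩ := last_common h3 hM hb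
        exact hMK z hz (hsK z (by simp [h4, hz']))
  · refine Or.inl ?_
    rcases List.append_eq_append_iff.1 h1 with ⟨b, h3, h4⟩ | ⟨b, h3, h4⟩
    · by_cases hb : b = []
      · subst hb
        exact ⟨[], by simpa using h3.symm, by simp [h2, h4]⟩
      · exfalso
        obtain ⟨z, hz, hz'⟩ := last_common h3 hs hb
        exact hMK z (by simp [h4, hz']) (hsK z hz)
    · exact ⟨b, h3, by rw [h2, h4]⟩

namespace DGr

theorem Sep.edge {G : DGr} {K : Set ℕ} {p a : ℕ} (h : G.Sep K p) (ha : a ∈ G.A)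
    (h1 : G.W a ≠ p) (h2 : G.E a ≠ p) : G.W a ∈ K ↔ G.E a ∈ K := by
  constructor
  · intro hk; by_contra hn
    exact h2 (h.2.2.1 _ _ hk ⟨a, ha, Or.inl ⟨rfl, rfl⟩⟩ hn)
  · intro hk; by_contra hn
    exact h1 (h.2.2.1 _ _ hk ⟨a, ha, Or.inr ⟨rfl, rfl⟩⟩ hn)

theorem Sep.mk' {G : DGr} {K : Set ℕ} {p : ℕ} (h1 : ∀ z ∈ K, z ∈ G.V) (h2 : p ∉ K)
    (h3 : ∀ a ∈ G.A, G.W a ≠ p → G.E a ≠ p → (G.W a ∈ K ↔ G.E a ∈ K))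
    (h4 : ∀ w, G.XVertex true w → w ∉ K) : G.Sep K p := by
  refine ⟨h1, h2, ?_, h4⟩
  rintro s t hs ⟨a, ha, ⟨rfl, rfl⟩ | ⟨rfl, rfl⟩⟩ ht
  · by_contra hn
    exact ht ((h3 a ha (fun h => h2 (h ▸ hs)) hn).1 hs)
  · by_contra hn
    exact ht ((h3 a ha hn (fun h => h2 (h ▸ hs))).2 hs)

end DGr

theorem Construction.lemR {D : DGr} {LW LE : List ℕ} (h : Construction D LW LE) :
    ∀ (K : Set ℕ) (p : ℕ), D.Sep K p → ∀ l1 s l2, LE = l1 ++ s ++ l2 → (∀ z ∈ s, z ∈ K) →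
      (∀ z ∈ l1, z ∉ K) → (∀ z ∈ l2, z ∉ K) → Construction D LW (l1 ++ s.reverse ++ l2) := by
  refine Construction.ind' (motive := fun D LW LE => ∀ (K : Set ℕ) (p : ℕ), D.Sep K p →
    ∀ l1 s l2, LE = l1 ++ s ++ l2 → (∀ z ∈ s, z ∈ K) →
      (∀ z ∈ l1, z ∉ K) → (∀ z ∈ l2, z ∉ K) → Construction D LW (l1 ++ s.reverse ++ l2)) ?_ ?_ h
  · rintro G LW LE hG h1 h2 K p hS l1 s l2 rfl _ _ _
    exact .basic G _ _ hG h1 (isList_perm h2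
      (((List.reverse_perm s).symm.append_left l1).append_right l2))
  · intro GW GE LWW LEE Φe Ξ Ψe Φw Ψw c1 c2 hJ hΞ hΦ hΨ he hw hX ih1 ih2 K p hS l1 s l2 hL hs hl1 hl2
    by_cases hs0 : s = []
    · subst hs0
      rw [List.reverse_nil, ← hL]
      exact c1.box' c2 hJ hΞ hΦ hΨ (fun z hz => (he z hz).2)
    have hKV : ∀ z ∈ K, (z ∈ GW.V ∧ z ∉ GE.V) ∨ (z ∈ GE.V ∧ z ∉ GW.V) :=
      fun z hz => hJ.memV.1 (hS.1 z hz)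
    -- edges in the juncture
    have eW : ∀ a ∈ GW.A, a ∉ GE.A → GW.W a ≠ p → GW.E a ≠ p → (GW.W a ∈ K ↔ GW.E a ∈ K) := by
      intro a ha ha' h1 h2
      have := hS.edge (a := a) (junc_A.2 (Or.inl ha))
      rw [junc_W ha, junc_E' ha' ha] at this
      exact this h1 h2
    have eE : ∀ a ∈ GE.A, a ∉ GW.A → GE.W a ≠ p → GE.E a ≠ p → (GE.W a ∈ K ↔ GE.E a ∈ K) := by
      intro a ha ha' h1 h2
      have := hS.edge (a := a) (junc_A.2 (Or.inr ha))
      rw [junc_W' ha' ha, junc_E ha] at this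
      exact this h1 h2
    have eC : ∀ a ∈ GW.A, a ∈ GE.A → GW.W a ≠ p → GE.E a ≠ p → (GW.W a ∈ K ↔ GE.E a ∈ K) := by
      intro a ha ha' h1 h2
      have := hS.edge (a := a) (junc_A.2 (Or.inl ha))
      rw [junc_W ha, junc_E ha'] at this
      exact this h1 h2
    have wW : ∀ w, GW.XVertex true w → w ∉ GE.V := by
      intro w hw h
      obtain ⟨c, hc, hc', rfl⟩ := hJ.common.1 ⟨hw.1, h⟩
      exact hw.2 c hc rfl
    have wWK : ∀ w, GW.XVertex true w → w ∉ K := fun w hw => hS.2.2.2 w (hJ.xv_true.2 (Or.inl hw))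
    have wEK : ∀ w, GE.XVertex true w → w ∉ GW.V → w ∉ K :=
      fun w hw h => hS.2.2.2 w (hJ.xv_true.2 (Or.inr ⟨hw, h⟩))
    have hLEE : ∀ z ∈ LEE, z ∈ GE.V ∧ z ∉ GW.V := by
      intro z hz
      have hz' := (c2.lists.2.1.2 z).1 hz
      refine ⟨hz'.1, fun h => ?_⟩
      obtain ⟨c, hc, hc', rfl⟩ := hJ.common.1 ⟨h, hz'.1⟩
      exact hz'.2 c hc' (hJ.cE hc hc').symm
    by_cases hp : p ∈ GW.V ∧ p ∉ GE.V
    · have hall : ∀ u v, u ∈ GE.V → u ∉ GW.V → v ∈ GE.V → v ∉ GW.V → u ∈ K → v ∈ K := by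
        intro u v hu hu' hv hv' huK
        refine conn_cut hJ.2.1 true (fun c => c ∈ GW.A ∧ c ∈ GE.A) K
          (fun c hc => hJ.cXE hc.1 hc.2) ?_ hu hv ?_ ?_ huK
        · intro a ha hc
          have ha' : a ∉ GW.A := fun h => hc ⟨h, ha⟩
          exact eE a ha ha' (fun h => (hJ.EW ha ha').2 (h ▸ hp.1)) (fun h => (hJ.EE ha).2 (h ▸ hp.1))
        · intro c hc h
          change GE.W c = u at h
          rw [← hJ.cE hc.1 hc.2] at h
          exact hu' (h ▸ (hJ.CC hc.1 hc.2).1)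
        · intro c hc h
          change GE.W c = v at h
          rw [← hJ.cE hc.1 hc.2] at h
          exact hv' (h ▸ (hJ.CC hc.1 hc.2).1)
      by_cases hex : ∃ u, u ∈ GE.V ∧ u ∉ GW.V ∧ u ∈ K
      · obtain ⟨u, hu, hu', huK⟩ := hex
        have hall' : ∀ v, v ∈ GE.V → v ∉ GW.V → v ∈ K := fun v hv hv' => hall u v hu hu' hv hv' huK
        have hΦw : ∀ z, ¬ (z ∈ Φw ∨ z ∈ Ψw) := by
          intro z hz
          obtain ⟨h1, h2⟩ := hw z hz
          exact wEK z ((c2.lists.1.2 z).1 (by simp; tauto)) h2 (hall' z h1 h2)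
        have e1 : Φw = [] := List.eq_nil_iff_forall_not_mem.2 fun z hz => hΦw z (Or.inl hz)
        have e2 : Ψw = [] := List.eq_nil_iff_forall_not_mem.2 fun z hz => hΦw z (Or.inr hz)
        subst e1 e2
        have hS' : GW.Sep {z | z ∈ GW.V ∧ (z ∈ K ∨ z ∈ GE.V)} p := by
          refine Sep.mk' (fun z hz => hz.1) ?_ ?_ ?_
          · rintro ⟨_, h | h⟩
            · exact hS.2.1 h
            · exact hp.2 h
          · intro a ha h1 h2
            obtain ⟨q1, q2⟩ := hJ.WW ha
            by_cases ha' : a ∈ GE.A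
            · obtain ⟨q3, q4⟩ := hJ.EE ha'
              have h3 := (eC a ha ha' h1 (fun h => q4 (h ▸ hp.1))).2 (hall' _ q3 q4)
              obtain ⟨q5, q6⟩ := hJ.CC ha ha'
              exact ⟨fun _ => ⟨q5, Or.inr q6⟩, fun _ => ⟨q1, Or.inl h3⟩⟩
            · have h3 := eW a ha ha' h1 h2
              obtain ⟨q3, q4⟩ := hJ.WE ha ha'
              constructor
              · rintro ⟨_, h | h⟩
                · exact ⟨q3, Or.inl (h3.1 h)⟩
                · exact absurd h q2
              · rintro ⟨_, h | h⟩
                · exact ⟨q1, Or.inl (h3.2 h)⟩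
                · exact absurd h q4
          · rintro w hw ⟨_, h | h⟩
            · exact wWK w hw h
            · exact wW w hw h
        obtain ⟨m1, m2, r1, r2, r3⟩ := LL1 (K := K) hL.symm c2.lists.2.2.2
          (fun z hz => hall' z (hLEE z hz).1 (hLEE z hz).2) hl1 hl2
        have hm : ∀ z, z ∈ m1 ∨ z ∈ m2 → z ∈ K ∧ z ∈ GW.V := by
          intro z hz
          refine ⟨hs z (by simp [r3]; tauto), (he z ?_).1⟩
          rw [r1, r2]; simp; tauto
        have hl : ∀ z, z ∈ l1 ∨ z ∈ l2 → z ∉ {z | z ∈ GW.V ∧ (z ∈ K ∨ z ∈ GE.V)} := by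
          rintro z hz ⟨_, h | h⟩
          · rcases hz with hz | hz
            · exact hl1 z hz h
            · exact hl2 z hz h
          · refine (he z ?_).2 h
            rw [r1, r2]; simp; tauto
        have c3 := ih1 _ p hS' l1 (m1 ++ Ξ ++ m2) l2 (by simp [r1, r2]) ?_
          (fun z hz => hl z (Or.inl hz)) (fun z hz => hl z (Or.inr hz))
        · have c4 := c2.rev
          have := Construction.box' (GW := GW) (GE := GE) (LWW := LWW) (LEE := LEE.reverse)
            (Φe := l1 ++ m2.reverse)
            (Ξ := Ξ.reverse) (Ψe := m1.reverse ++ l2) (Φw := []) (Ψw := [])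
            (by simpa using c3) (by simpa using c4) hJ (by simpa using hΞ) (Or.inr rfl) (Or.inr rfl) ?_
          · simpa [r3] using this
          · intro z hz
            refine (he z ?_).2
            rw [r1, r2]; simp at hz ⊢; tauto
        · intro z hz
          simp only [List.mem_append] at hz
          rcases hz with (hz | hz) | hz
          · exact ⟨(hm z (Or.inl hz)).2, Or.inl (hm z (Or.inl hz)).1⟩
          · exact ⟨((hX z).1 hz).1, Or.inr ((hX z).1 hz).2⟩
          · exact ⟨(hm z (Or.inr hz)).2, Or.inl (hm z (Or.inr hz)).1⟩
      · have hnone : ∀ v, v ∈ GE.V → v ∉ K := by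
          intro v hv hk
          rcases hKV v hk with h | h
          · exact h.2 hv
          · exact hex ⟨v, h.1, h.2, hk⟩
        have hS' : GW.Sep K p := by
          refine Sep.mk' ?_ hS.2.1 ?_ wWK
          · intro z hz
            rcases hKV z hz with h | h
            · exact h.1
            · exact absurd hz (hnone z h.1)
          · intro a ha h1 h2
            by_cases ha' : a ∈ GE.A
            · have h3 := eC a ha ha' h1 (fun h => (hJ.EE ha').2 (h ▸ hp.1))
              have h4 := hnone _ (hJ.EE ha').1
              have h5 := hnone _ (hJ.CC ha ha').2
              tauto
            · exact eW a ha ha' h1 h2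
        have hMK : ∀ z ∈ LEE, z ∉ K := fun z hz => hnone z (hLEE z hz).1
        have hΞK : ∀ z ∈ Ξ, z ∉ K := fun z hz => hnone z ((hX z).1 hz).2
        rcases LL2 hL hs0 c2.lists.2.2.2 hs hMK with ⟨m, r1, r2⟩ | ⟨m, r1, r2⟩
        · have c3 := ih1 K p hS' l1 s (m ++ Ξ ++ Ψe) (by simp [r1]) hs hl1 (by
            intro z hz
            simp only [List.mem_append] at hz
            rcases hz with (hz | hz) | hz
            · exact hl2 z (by simp [r2, hz])
            · exact hΞK z hz
            · exact hl2 z (by simp [r2, hz]))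
          have hΦw : Φw = [] := by
            rcases hΦ with h | h
            · rw [r1] at h; simp at h; exact absurd h.2.1 hs0
            · exact h
          have := Construction.box' (GW := GW) (GE := GE) (LWW := LWW) (LEE := LEE)
            (Φe := l1 ++ s.reverse ++ m)
            (Ξ := Ξ) (Ψe := Ψe) (Φw := Φw) (Ψw := Ψw)
            (by simpa using c3) c2 hJ hΞ (Or.inr hΦw) hΨ ?_
          · simpa [r2] using this
          · intro z hz
            refine (he z ?_).2
            rw [r1]; simp at hz ⊢; tauto
        · have c3 := ih1 K p hS' (Φe ++ Ξ ++ m) s l2 (by simp [r1]) hs (by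
            intro z hz
            simp only [List.mem_append] at hz
            rcases hz with (hz | hz) | hz
            · exact hl1 z (by simp [r2, hz])
            · exact hΞK z hz
            · exact hl1 z (by simp [r2, hz])) hl2
          have hΨw : Ψw = [] := by
            rcases hΨ with h | h
            · rw [r1] at h; simp at h; exact absurd h.2.1 hs0
            · exact h
          have := Construction.box' (GW := GW) (GE := GE) (LWW := LWW) (LEE := LEE)
            (Φe := Φe)
            (Ξ := Ξ) (Ψe := m ++ s.reverse ++ l2) (Φw := Φw) (Ψw := Ψw)
            (by simpa using c3) c2 hJ hΞ hΦ (Or.inr hΨw) ?_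
          · simpa [r2] using this
          · intro z hz
            refine (he z ?_).2
            rw [r1]; simp at hz ⊢; tauto
    · have hpW : ∀ z, z ∈ GW.V → z ∉ GE.V → z ≠ p := fun z h1 h2 h => hp (h ▸ ⟨h1, h2⟩)
      obtain ⟨w, hwL⟩ := List.exists_mem_of_ne_nil _ c1.lists.2.2.1
      have hwX := (c1.lists.1.2 w).1 hwL
      have hnone : ∀ v, v ∈ GW.V → v ∉ K := by
        intro v hv hvK
        have hv' : v ∉ GE.V := by
          rcases hKV v hvK with h | h
          · exact h.2
          · exact absurd hv h.2
        refine wWK w hwX (conn_cut hJ.1 false (fun c => c ∈ GW.A ∧ c ∈ GE.A) K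
          (fun c hc => hJ.cXW hc.1 hc.2) ?_ hv hwX.1 ?_ ?_ hvK)
        · intro a ha hc
          have ha' : a ∉ GE.A := fun h => hc ⟨ha, h⟩
          exact eW a ha ha' (hpW _ (hJ.WW ha).1 (hJ.WW ha).2) (hpW _ (hJ.WE ha ha').1 (hJ.WE ha ha').2)
        · intro c hc h
          change GW.E c = v at h
          exact hv' (h ▸ (hJ.CC hc.1 hc.2).2)
        · intro c hc h
          change GW.E c = w at h
          exact wW w hwX (h ▸ (hJ.CC hc.1 hc.2).2)
      have hS' : GE.Sep K p := by
        refine Sep.mk' ?_ hS.2.1 ?_ ?_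
        · intro z hz
          rcases hKV z hz with h | h
          · exact absurd hz (hnone z h.1)
          · exact h.1
        · intro a ha h1 h2
          by_cases ha' : a ∈ GW.A
          · have h3 := eC a ha' ha (hpW _ (hJ.WW ha').1 (hJ.WW ha').2) h2
            have h4 := hnone _ (hJ.WW ha').1
            have h5 := hnone _ (hJ.CC ha' ha).1
            rw [hJ.cE ha' ha] at h5
            tauto
          · exact eE a ha ha' h1 h2
        · intro w hw hk
          rcases hKV w hk with h | h
          · exact hnone w h.1 hk
          · exact wEK w hw h.2 hk
      obtain ⟨m1, m2, r1, r2, r3⟩ := LL1 (K := K) hL hs0 hs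
        (fun z hz => hnone z (he z (Or.inl hz)).1) (fun z hz => hnone z (he z (Or.inr hz)).1)
      have c3 := ih2 K p hS' m1 s m2 r3 hs (fun z hz => hl1 z (by simp [r1, hz]))
        (fun z hz => hl2 z (by simp [r2, hz]))
      have := c1.box' c3 hJ hΞ hΦ hΨ (fun z hz => (he z hz).2)
      simpa [r1, r2] using this

/- ===== Part 6: mod 2 chains; lists of constructions are grounded ===== -/
open DGr

def Bf (f g : ℕ → ZMod 2) : List ℕ → ZMod 2
  | [] => 0
  | m :: M => f m * (M.map g).sum + Bf f g M

theorem Bf_append (f g : ℕ → ZMod 2) (M N : List ℕ) :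
    Bf f g (M ++ N) = Bf f g M + (M.map f).sum * (N.map g).sum + Bf f g N := by
  induction M with
  | nil => simp [Bf]
  | cons m M ih => simp only [List.cons_append, Bf, ih, List.map_append, List.sum_append,
      List.map_cons, List.sum_cons]; ring

theorem Bf_reverse (f g : ℕ → ZMod 2) (M : List ℕ) : Bf f g M.reverse = Bf g f M := by
  induction M with
  | nil => simp [Bf]
  | cons m M ih =>
    rw [List.reverse_cons, Bf_append, ih]
    simp [Bf, List.map_reverse, List.sum_reverse]; ring

theorem Bf_diag (f g : ℕ → ZMod 2) (M : List ℕ) (h : ∀ z ∈ M, f z * g z = 0) :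
    Bf f g M + Bf g f M = (M.map f).sum * (M.map g).sum := by
  induction M with
  | nil => simp [Bf]
  | cons m M ih =>
    have h1 := ih (fun z hz => h z (by simp [hz]))
    have h2 := h m (by simp)
    simp only [Bf, List.map_cons, List.sum_cons]
    linear_combination h1 - h2

theorem map_sum_congr {f f' : ℕ → ZMod 2} {M : List ℕ} (h : ∀ z ∈ M, f z = f' z) :
    (M.map f).sum = (M.map f').sum := by
  rw [List.map_congr_left h]

theorem Bf_congr {f f' g g' : ℕ → ZMod 2} {M : List ℕ} (h : ∀ z ∈ M, f z = f' z)
    (h' : ∀ z ∈ M, g z = g' z) : Bf f g M = Bf f' g' M := by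
  induction M with
  | nil => rfl
  | cons m M ih =>
    simp only [Bf]
    rw [h m (by simp), map_sum_congr (fun z hz => h' z (by simp [hz])),
      ih (fun z hz => h z (by simp [hz])) (fun z hz => h' z (by simp [hz]))]

theorem Bf_zero {f g : ℕ → ZMod 2} {M : List ℕ} (h : ∀ z ∈ M, f z = 0) : Bf f g M = 0 := by
  induction M with
  | nil => rfl
  | cons m M ih =>
    simp [Bf, h m (by simp), ih (fun z hz => h z (by simp [hz]))]

theorem two_zero (x : ZMod 2) : x + x = 0 := by revert x; decide

theorem alg_core {R : Type} [CommRing R] (t2 : (2 : R) = 0)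
    (af ag bf bg pf pg xf xg qf qg rf rg sf sg A B P X X' Q U V : R)
    (z1 : pf * rg = 0) (z2 : rf * pg = 0) (z3 : qf * sg = 0) (z4 : sf * qg = 0)
    (sf1 : af + (pf + xf + qf) = 0) (sg1 : ag + (pg + xg + qg) = 0)
    (sf2 : rf + xf + sf + bf = 0) (sg2 : rg + xg + sg + bg = 0)
    (h1 : A + af * (qg + (xg + pg)) + (Q + qf * (xg + pg) + (X' + xf * pg + P)) = 0)
    (h2 : U + rf * xg + X + (rf + xf) * sg + V + (rf + xf + sf) * bg + B = 0)
    (h3 : X + X' = xf * xg) :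
    U + rf * ag + A + (rf + af) * sg + V + (rf + af + sf) * (qg + (bg + pg)) +
      (Q + qf * (bg + pg) + (B + bf * pg + P)) = 0 := by
  have e1 : af = -(pf + xf + qf) := by linear_combination sf1
  have e2 : ag = -(pg + xg + qg) := by linear_combination sg1
  have e3 : bf = -(rf + xf + sf) := by linear_combination sf2
  have e4 : bg = -(rg + xg + sg) := by linear_combination sg2
  subst e1 e2 e3 e4
  linear_combination h1 + h2 - h3 + z1 + z2 + z3 + z4 + ((-1) * (rf * xg) + (1) * (pf * xg) + (1) * (rg * xf) + (1) * (xf * xg) + (-1) * (pg * xf) + (-1) * (qf * sg) + (-1) * (pg * rf)) * t2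

theorem alg_box (f g : ℕ → ZMod 2) (A B Φe Ξ Ψe Φw Ψw : List ℕ)
    (hΦ : Φe = [] ∨ Φw = []) (hΨ : Ψe = [] ∨ Ψw = [])
    (sf1 : (A.map f).sum + ((Φe ++ Ξ ++ Ψe).map f).sum = 0)
    (sg1 : (A.map g).sum + ((Φe ++ Ξ ++ Ψe).map g).sum = 0)
    (sf2 : ((Φw ++ Ξ ++ Ψw).map f).sum + (B.map f).sum = 0)
    (sg2 : ((Φw ++ Ξ ++ Ψw).map g).sum + (B.map g).sum = 0)
    (h1 : Bf f g (A ++ (Φe ++ Ξ ++ Ψe).reverse) = 0)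
    (h2 : Bf f g ((Φw ++ Ξ ++ Ψw) ++ B.reverse) = 0)
    (hd : ∀ z ∈ Ξ, f z * g z = 0) :
    Bf f g ((Φw ++ A ++ Ψw) ++ (Φe ++ B ++ Ψe).reverse) = 0 := by
  have h3 := Bf_diag f g Ξ hd
  have p1 : (Φe.map f).sum * (Φw.map g).sum = 0 := by rcases hΦ with rfl | rfl <;> simp
  have p2 : (Φw.map f).sum * (Φe.map g).sum = 0 := by rcases hΦ with rfl | rfl <;> simp
  have p3 : (Ψe.map f).sum * (Ψw.map g).sum = 0 := by rcases hΨ with rfl | rfl <;> simp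
  have p4 : (Ψw.map f).sum * (Ψe.map g).sum = 0 := by rcases hΨ with rfl | rfl <;> simp
  simp only [Bf_append, Bf_reverse, List.reverse_append, List.map_append, List.sum_append,
    List.map_reverse, List.sum_reverse] at sf1 sg1 sf2 sg2 h1 h2 ⊢
  exact alg_core (R := ZMod 2) rfl _ _ _ _ _ _ _ _ _ _ _ _ _ _ _ _ _ _ _ _ _ _
    p1 p2 p3 p4 sf1 sg1 sf2 sg2 h1 h2 h3

/- ===== Part 7: boundaries ===== -/
namespace DGr

def ind (x y : ℕ) : ZMod 2 := if x = y then 1 else 0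

def bd (G : DGr) (F : ℕ → ZMod 2) (v : ℕ) : ZMod 2 :=
  ∑ a ∈ G.A, F a * (ind (G.W a) v + ind (G.E a) v)

def inc (G : DGr) (a z : ℕ) : Prop := G.W a = z ∨ G.E a = z

def Djt (G : DGr) (F F' : ℕ → ZMod 2) : Prop :=
  ∀ a ∈ G.A, ∀ b ∈ G.A, F a ≠ 0 → F' b ≠ 0 → ∀ z, G.inc a z → G.inc b z → False

def Clo (G : DGr) (F : ℕ → ZMod 2) : Prop := ∀ v, G.InnerVertex v → G.bd F v = 0

theorem bd_ne {G : DGr} {F : ℕ → ZMod 2} {v : ℕ} (h : G.bd F v ≠ 0) :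
    ∃ a ∈ G.A, F a ≠ 0 ∧ G.inc a v := by
  obtain ⟨a, ha, h1⟩ := Finset.exists_ne_zero_of_sum_ne_zero h
  refine ⟨a, ha, left_ne_zero_of_mul h1, ?_⟩
  by_contra hn
  simp only [inc, not_or] at hn
  apply h1
  simp [ind, hn.1, hn.2]

theorem bd_mul {G : DGr} {F F' : ℕ → ZMod 2} (h : G.Djt F F') (z : ℕ) :
    G.bd F z * G.bd F' z = 0 := by
  by_contra hn
  obtain ⟨a, ha, h1, h2⟩ := bd_ne (left_ne_zero_of_mul hn)
  obtain ⟨b, hb, h3, h4⟩ := bd_ne (right_ne_zero_of_mul hn)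
  exact h a ha b hb h1 h3 z h2 h4

theorem bd_iso {G : DGr} {F : ℕ → ZMod 2} {v : ℕ} (h1 : G.XVertex true v) (h2 : G.XVertex false v) :
    G.bd F v = 0 := by
  by_contra hn
  obtain ⟨a, ha, _, h | h⟩ := bd_ne hn
  · exact h2.2 a ha h
  · exact h1.2 a ha h

theorem bd_sum {G : DGr} (hw : G.WellFormed) (F : ℕ → ZMod 2) : ∑ v ∈ G.V, G.bd F v = 0 := by
  unfold bd
  rw [Finset.sum_comm]
  refine Finset.sum_eq_zero fun a ha => ?_
  rw [← Finset.mul_sum, Finset.sum_add_distrib]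
  simp only [ind, Finset.sum_ite_eq, (hw a ha).1, (hw a ha).2, if_true]
  rw [two_zero, mul_zero]

theorem handshake {G : DGr} (hw : G.WellFormed) {F : ℕ → ZMod 2} (hF : G.Clo F) {LW LE : List ℕ}
    (h1 : G.IsListOfX true LW) (h2 : G.IsListOfX false LE) :
    (LW.map (G.bd F)).sum + (LE.map (G.bd F)).sum = 0 := by
  rw [← List.sum_toFinset _ h1.1, ← List.sum_toFinset _ h2.1, ← Finset.sum_union_inter]
  have e1 : ∑ v ∈ LW.toFinset ∩ LE.toFinset, G.bd F v = 0 := by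
    refine Finset.sum_eq_zero fun v hv => ?_
    simp only [Finset.mem_inter, List.mem_toFinset] at hv
    exact bd_iso ((h1.2 v).1 hv.1) ((h2.2 v).1 hv.2)
  have e2 : ∑ v ∈ LW.toFinset ∪ LE.toFinset, G.bd F v = ∑ v ∈ G.V, G.bd F v := by
    refine Finset.sum_subset ?_ ?_
    · intro v hv
      simp only [Finset.mem_union, List.mem_toFinset] at hv
      rcases hv with hv | hv
      · exact ((h1.2 v).1 hv).1
      · exact ((h2.2 v).1 hv).1
    · intro v hv hn
      simp only [Finset.mem_union, List.mem_toFinset, not_or] at hn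
      exact hF v ⟨hv, fun h => hn.1 ((h1.2 v).2 h), fun h => hn.2 ((h2.2 v).2 h)⟩
  rw [e1, e2, bd_sum hw, add_zero]

theorem basic_edge {G : DGr} (hG : G.IsDGraph) {v : ℕ} (hv : G.InnerVertex v)
    (hu : ∀ u, G.InnerVertex u → u = v) {a : ℕ} (ha : a ∈ G.A) : G.inc a v := by
  by_contra hn
  simp only [inc, not_or] at hn
  have h1 : G.XVertex true (G.W a) := by
    by_contra h
    exact hn.1 (hu _ ⟨(hG.1 a ha).1, h, fun h' => h'.2 a ha rfl⟩)
  have h2 : G.XVertex false (G.E a) := by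
    by_contra h
    exact hn.2 (hu _ ⟨(hG.1 a ha).2, fun h' => h'.2 a ha rfl, h⟩)
  have := conn_closed hG.2.2.2.1 (T := {z | z = G.W a ∨ z = G.E a}) ?_ (hG.1 a ha).1 hv.1 (Or.inl rfl)
  · rcases this with h | h
    · exact hn.1 h.symm
    · exact hn.2 h.symm
  · intro b hb
    by_cases hba : b = a
    · subst hba; simp
    · constructor
      · rintro (h | h)
        · exact absurd h (hG.2.2.1 true a ⟨ha, h1⟩ b hb hba)
        · exact absurd h (h2.2 b hb)
      · rintro (h | h)
        · exact absurd h (h1.2 b hb)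
        · exact absurd h (hG.2.2.1 false a ⟨ha, h2⟩ b hb hba)

theorem ind_ne {x y : ℕ} (h : x ≠ y) : ind x y = 0 := by simp [ind, h]

namespace JuncDefined
variable {GW GE : DGr}

theorem bdW (h : GW.JuncDefined GE) (F : ℕ → ZMod 2) {v : ℕ} (hv : v ∈ GW.V) (hv' : v ∉ GE.V) :
    (GW.junc GE).bd F v = GW.bd F v := by
  unfold bd
  symm
  have : GW.A ⊆ (GW.junc GE).A := fun a ha => junc_A.2 (Or.inl ha)
  rw [← Finset.sum_subset this]
  · refine Finset.sum_congr rfl fun a ha => ?_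
    rw [junc_W ha]
    by_cases ha' : a ∈ GE.A
    · rw [junc_E ha', ind_ne (x := GW.E a), ind_ne (x := GE.E a)]
      · rintro rfl; exact hv' (h.EE ha').1
      · rintro rfl; exact hv' (h.CC ha ha').2
    · rw [junc_E' ha' ha]
  · intro a ha ha'
    have ha2 : a ∈ GE.A := (junc_A.1 ha).resolve_left ha'
    rw [junc_W' ha' ha2, junc_E ha2, ind_ne (x := GE.W a), ind_ne (x := GE.E a)]
    · simp
    · rintro rfl; exact hv' (h.EE ha2).1
    · rintro rfl; exact hv' (h.EW ha2 ha').1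

theorem bdE (h : GW.JuncDefined GE) (F : ℕ → ZMod 2) {v : ℕ} (hv : v ∈ GE.V) (hv' : v ∉ GW.V) :
    (GW.junc GE).bd F v = GE.bd F v := by
  unfold bd
  symm
  have : GE.A ⊆ (GW.junc GE).A := fun a ha => junc_A.2 (Or.inr ha)
  rw [← Finset.sum_subset this]
  · refine Finset.sum_congr rfl fun a ha => ?_
    rw [junc_E ha]
    by_cases ha' : a ∈ GW.A
    · rw [junc_W ha', ind_ne (x := GW.W a), ind_ne (x := GE.W a)]
      · rintro rfl; rw [← h.cE ha' ha] at hv'; exact hv' (h.CC ha' ha).1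
      · rintro rfl; exact hv' (h.WW ha').1
    · rw [junc_W' ha' ha]
  · intro a ha ha'
    have ha2 : a ∈ GW.A := (junc_A.1 ha).resolve_right ha'
    rw [junc_W ha2, junc_E' ha' ha2, ind_ne (x := GW.W a), ind_ne (x := GW.E a)]
    · simp
    · rintro rfl; exact hv' (h.WE ha2 ha').1
    · rintro rfl; exact hv' (h.WW ha2).1

theorem bdC (h : GW.JuncDefined GE) (F : ℕ → ZMod 2) {v : ℕ} (hv : v ∈ GW.V) (hv' : v ∈ GE.V) :
    GW.bd F v = GE.bd F v := by
  obtain ⟨c, hc, hc', rfl⟩ := h.common.1 ⟨hv, hv'⟩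
  have e1 : GW.bd F (GW.E c) = F c := by
    unfold bd
    rw [Finset.sum_eq_single_of_mem c hc]
    · rw [ind_ne (x := GW.W c) (y := GW.E c) ((h.comW hv hv').2 c hc)]; simp [ind]
    · intro b hb hbc
      rw [ind_ne (x := GW.W b) (y := GW.E c) ((h.comW hv hv').2 b hb),
        ind_ne (x := GW.E b) (y := GW.E c) (h.1.2.2.1 false c (h.cXW hc hc') b hb hbc)]; simp
  have e2 : GE.bd F (GE.W c) = F c := by
    have h1 := h.comE hv hv'
    rw [h.cE hc hc'] at h1
    unfold bd
    rw [Finset.sum_eq_single_of_mem c hc']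
    · rw [ind_ne (x := GE.E c) (y := GE.W c) (h1.2 c hc')]; simp [ind]
    · intro b hb hbc
      rw [ind_ne (x := GE.E b) (y := GE.W c) (h1.2 b hb),
        ind_ne (x := GE.W b) (y := GE.W c) (h.2.1.2.2.1 true c (h.cXE hc hc') b hb hbc)]; simp
  rw [e1, h.cE hc hc', e2]

theorem cloW (h : GW.JuncDefined GE) {F : ℕ → ZMod 2} (hF : (GW.junc GE).Clo F) : GW.Clo F := by
  rintro v ⟨hv, h1, h2⟩
  have hv' : v ∉ GE.V := fun hv' => h2 (h.comW hv hv')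
  rw [← h.bdW F hv hv']
  refine hF v ⟨h.memV.2 (Or.inl ⟨hv, hv'⟩), ?_, ?_⟩
  · rw [h.xv_true]; tauto
  · rw [h.xv_false]; rintro (h3 | h3)
    · exact hv' h3.1
    · exact h2 h3.1

theorem cloE (h : GW.JuncDefined GE) {F : ℕ → ZMod 2} (hF : (GW.junc GE).Clo F) : GE.Clo F := by
  rintro v ⟨hv, h1, h2⟩
  have hv' : v ∉ GW.V := fun hv' => h1 (h.comE hv' hv)
  rw [← h.bdE F hv hv']
  refine hF v ⟨h.memV.2 (Or.inr ⟨hv, hv'⟩), ?_, ?_⟩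
  · rw [h.xv_true]; rintro (h3 | h3)
    · exact hv' h3.1
    · exact h1 h3.1
  · rw [h.xv_false]; tauto

theorem djtW (h : GW.JuncDefined GE) {F F' : ℕ → ZMod 2} (hF : (GW.junc GE).Djt F F') :
    GW.Djt F F' := by
  intro a ha b hb h1 h2 z hza hzb
  have hD := hF a (junc_A.2 (Or.inl ha)) b (junc_A.2 (Or.inl hb)) h1 h2
  by_cases hz : z ∈ GE.V
  · have key : ∀ a ∈ GW.A, GW.inc a z → GW.E a = z := by
      rintro a ha (rfl | h)
      · exact absurd hz (h.WW ha).2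
      · exact h
    have ea := key a ha hza
    have eb := key b hb hzb
    have hab : b = a := by
      by_contra hne
      have hX : GW.XVertex false (GW.E a) := by
        rw [ea]; exact h.comW (ea ▸ (h.1.1 a ha).2) hz
      exact h.1.2.2.1 false a ⟨ha, hX⟩ b hb hne (eb.trans ea.symm)
    subst hab
    exact hD _ (Or.inl rfl) (Or.inl rfl)
  · have key : ∀ a ∈ GW.A, GW.inc a z → (GW.junc GE).inc a z := by
      rintro a ha (h3 | h3)
      · left; rwa [junc_W ha]
      · right
        have : a ∉ GE.A := fun ha' => hz (h3 ▸ (h.CC ha ha').2)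
        rwa [junc_E' this ha]
    exact hD z (key a ha hza) (key b hb hzb)

theorem djtE (h : GW.JuncDefined GE) {F F' : ℕ → ZMod 2} (hF : (GW.junc GE).Djt F F') :
    GE.Djt F F' := by
  intro a ha b hb h1 h2 z hza hzb
  have hD := hF a (junc_A.2 (Or.inr ha)) b (junc_A.2 (Or.inr hb)) h1 h2
  by_cases hz : z ∈ GW.V
  · have key : ∀ a ∈ GE.A, GE.inc a z → GE.W a = z := by
      rintro a ha (h | rfl)
      · exact h
      · exact absurd hz (h.EE ha).2
    have ea := key a ha hza
    have eb := key b hb hzb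
    have hab : b = a := by
      by_contra hne
      have hX : GE.XVertex true (GE.W a) := by
        rw [ea]; exact h.comE hz (ea ▸ (h.2.1.1 a ha).1)
      exact h.2.1.2.2.1 true a ⟨ha, hX⟩ b hb hne (eb.trans ea.symm)
    subst hab
    exact hD _ (Or.inr rfl) (Or.inr rfl)
  · have key : ∀ a ∈ GE.A, GE.inc a z → (GW.junc GE).inc a z := by
      rintro a ha (h3 | h3)
      · left
        have : a ∉ GW.A := fun ha' => hz (by rw [← h3, ← h.cE ha' ha]; exact (h.CC ha' ha).1)
        rwa [junc_W' this ha]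
      · right; rwa [junc_E ha]
    exact hD z (key a ha hza) (key b hb hzb)

end JuncDefined
end DGr

open DGr

theorem Construction.chain {D : DGr} {LW LE : List ℕ} (h : Construction D LW LE) :
    ∀ F F', D.Clo F → D.Clo F' → D.Djt F F' → Bf (D.bd F) (D.bd F') (LW ++ LE.reverse) = 0 := by
  refine Construction.ind' (motive := fun D LW LE => ∀ F F', D.Clo F → D.Clo F' → D.Djt F F' →
    Bf (D.bd F) (D.bd F') (LW ++ LE.reverse) = 0) ?_ ?_ h
  · rintro G LW LE ⟨hG, v, hv, hu⟩ h1 h2 F F' hF hF' hd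
    by_cases hz : ∃ a ∈ G.A, F a ≠ 0
    · obtain ⟨a, ha, hFa⟩ := hz
      have hz' : ∀ z, G.bd F' z = 0 := by
        intro z
        by_contra hn
        obtain ⟨b, hb, hb1, hb2⟩ := bd_ne hn
        exact hd a ha b hb hFa hb1 v (basic_edge hG hv hu ha) (basic_edge hG hv hu hb)
      rw [← List.reverse_reverse (LW ++ LE.reverse), Bf_reverse]
      exact Bf_zero fun z _ => hz' z
    · refine Bf_zero fun z _ => ?_
      by_contra hn
      obtain ⟨b, hb, hb1, hb2⟩ := bd_ne hn
      exact hz ⟨b, hb, hb1⟩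
  · intro GW GE LWW LEE Φe Ξ Ψe Φw Ψw c1 c2 hJ hΞ hΦ hΨ he hw hX ih1 ih2 F F' hF hF' hd
    let t : (ℕ → ZMod 2) → ℕ → ZMod 2 := fun F v => if v ∈ GW.V then GW.bd F v else GE.bd F v
    have tW : ∀ F v, v ∈ GW.V → GW.bd F v = t F v := fun F v hv => by simp [t, hv]
    have tE : ∀ F v, v ∈ GE.V → GE.bd F v = t F v := fun F v hv => by
      by_cases hv' : v ∈ GW.V
      · simp only [t, hv', if_true]; exact (hJ.bdC F hv' hv).symm
      · simp [t, hv']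
    have tD : ∀ F v, v ∈ (GW.junc GE).V → (GW.junc GE).bd F v = t F v := fun F v hv => by
      rcases hJ.memV.1 hv with ⟨h1, h2⟩ | ⟨h1, h2⟩
      · rw [hJ.bdW F h1 h2, tW F v h1]
      · rw [hJ.bdE F h1 h2, tE F v h1]
    have m1 : ∀ z ∈ LWW, z ∈ GW.V := fun z hz => ((c1.lists.1.2 z).1 hz).1
    have m2 : ∀ z ∈ Φe ++ Ξ ++ Ψe, z ∈ GW.V := fun z hz => ((c1.lists.2.1.2 z).1 hz).1
    have m3 : ∀ z ∈ Φw ++ Ξ ++ Ψw, z ∈ GE.V := fun z hz => ((c2.lists.1.2 z).1 hz).1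
    have m4 : ∀ z ∈ LEE, z ∈ GE.V := fun z hz => ((c2.lists.2.1.2 z).1 hz).1
    have c3 := c1.box' c2 hJ hΞ hΦ hΨ (fun z hz => (he z hz).2)
    have m5 : ∀ z ∈ Φw ++ LWW ++ Ψw, z ∈ (GW.junc GE).V := fun z hz => ((c3.lists.1.2 z).1 hz).1
    have m6 : ∀ z ∈ Φe ++ LEE ++ Ψe, z ∈ (GW.junc GE).V := fun z hz => ((c3.lists.2.1.2 z).1 hz).1
    have hs1 : ∀ F, GW.Clo F → (LWW.map (t F)).sum + ((Φe ++ Ξ ++ Ψe).map (t F)).sum = 0 := by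
      intro F hF
      rw [← handshake hJ.1.1 hF c1.lists.1 c1.lists.2.1,
        map_sum_congr (fun z hz => tW F z (m1 z hz)), map_sum_congr (fun z hz => tW F z (m2 z hz))]
    have hs2 : ∀ F, GE.Clo F → ((Φw ++ Ξ ++ Ψw).map (t F)).sum + (LEE.map (t F)).sum = 0 := by
      intro F hF
      rw [← handshake hJ.2.1.1 hF c2.lists.1 c2.lists.2.1,
        map_sum_congr (fun z hz => tE F z (m3 z hz)), map_sum_congr (fun z hz => tE F z (m4 z hz))]
    have q1 := ih1 F F' (hJ.cloW hF) (hJ.cloW hF') (hJ.djtW hd)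
    have q2 := ih2 F F' (hJ.cloE hF) (hJ.cloE hF') (hJ.djtE hd)
    have n1 : ∀ z ∈ LWW ++ (Φe ++ Ξ ++ Ψe).reverse, z ∈ GW.V := by
      intro z hz
      rw [List.mem_append, List.mem_reverse] at hz
      exact hz.elim (m1 z) (m2 z)
    have n2 : ∀ z ∈ (Φw ++ Ξ ++ Ψw) ++ LEE.reverse, z ∈ GE.V := by
      intro z hz
      rw [List.mem_append, List.mem_reverse] at hz
      exact hz.elim (m3 z) (m4 z)
    have n3 : ∀ z ∈ (Φw ++ LWW ++ Ψw) ++ (Φe ++ LEE ++ Ψe).reverse, z ∈ (GW.junc GE).V := by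
      intro z hz
      rw [List.mem_append, List.mem_reverse] at hz
      exact hz.elim (m5 z) (m6 z)
    rw [Bf_congr (fun z hz => tW F z (n1 z hz)) (fun z hz => tW F' z (n1 z hz))] at q1
    rw [Bf_congr (fun z hz => tE F z (n2 z hz)) (fun z hz => tE F' z (n2 z hz))] at q2
    rw [Bf_congr (fun z hz => tD F z (n3 z hz)) (fun z hz => tD F' z (n3 z hz))]
    refine alg_box _ _ _ _ _ Ξ _ _ _ hΦ hΨ (hs1 F (hJ.cloW hF)) (hs1 F' (hJ.cloW hF'))
      (hs2 F (hJ.cloE hF)) (hs2 F' (hJ.cloE hF')) q1 q2 ?_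
    intro z hz
    rw [← tW F z ((hX z).1 hz).1, ← tW F' z ((hX z).1 hz).1]
    exact bd_mul (hJ.djtW hd) z

/- ===== Part 8: lists of constructions are grounded ===== -/
namespace DGr

theorem no_iso {G : DGr} (hG : G.IsDGraph) {z : ℕ} (h1 : G.XVertex true z)
    (h2 : G.XVertex false z) : False := by
  obtain ⟨-, -, -, hc, v, hv⟩ := hG
  have : v ∈ ({z} : Set ℕ) := by
    refine conn_closed hc ?_ h1.1 hv.1 rfl
    intro a ha
    have e1 : G.E a ≠ z := h1.2 a ha
    have e2 : G.W a ≠ z := h2.2 a ha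
    simp [e1, e2]
  rw [Set.mem_singleton_iff] at this
  subst this
  exact hv.2.1 h1

def cnt (es : List ℕ) (a : ℕ) : ZMod 2 := (es.count a : ZMod 2)

theorem bd_cnt_cons {G : DGr} {b : ℕ} (hb : b ∈ G.A) (es : List ℕ) (z : ℕ) :
    G.bd (cnt (b :: es)) z = G.bd (cnt es) z + (ind (G.W b) z + ind (G.E b) z) := by
  have : ∀ a ∈ G.A, cnt (b :: es) a * (ind (G.W a) z + ind (G.E a) z) =
      cnt es a * (ind (G.W a) z + ind (G.E a) z) +
      (if b = a then (ind (G.W a) z + ind (G.E a) z) else 0) := by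
    intro a _
    unfold cnt
    rw [List.count_cons]
    by_cases h : b = a
    · subst h; simp [add_mul]
    · simp [h]
  unfold bd
  rw [Finset.sum_congr rfl this, Finset.sum_add_distrib, Finset.sum_ite_eq]
  simp [hb]

theorem walk_bd (G : DGr) : ∀ (es vs : List ℕ) (u v : ℕ), G.IsSemiwalk vs es →
    vs.head? = some u → vs.getLast? = some v →
    (∀ z, G.bd (cnt es) z = ind u z + ind v z) ∧ ∀ a ∈ es, G.W a ∈ vs ∧ G.E a ∈ vs := by
  intro es
  induction es with
  | nil =>
    intro vs u v h h1 h2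
    obtain ⟨x, rfl⟩ : ∃ x, vs = [x] := List.length_eq_one_iff.1 (by simpa using h.1)
    simp only [List.head?_cons, Option.some.injEq, List.getLast?_singleton] at h1 h2
    subst h1 h2
    refine ⟨fun z => ?_, by simp⟩
    rw [two_zero]
    simp [bd, cnt]
  | cons b es ih =>
    intro vs u v h h1 h2
    match vs, h, h1, h2 with
    | [], h, h1, h2 => simp at h1
    | [x], h, h1, h2 => have := h.1; simp at this
    | x :: y :: vs, h, h1, h2 =>
      simp only [List.head?_cons, Option.some.injEq] at h1
      subst h1
      obtain ⟨-, hb, hxy, h'⟩ := G.semiwalk_cons.1 h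
      rw [List.getLast?_cons_cons] at h2
      obtain ⟨i1, i2⟩ := ih (y :: vs) y v h' rfl h2
      constructor
      · intro z
        rw [bd_cnt_cons hb, i1]
        have := two_zero (ind y z)
        rcases hxy with ⟨rfl, rfl⟩ | ⟨rfl, rfl⟩ <;> linear_combination this
      · intro a ha
        rcases List.mem_cons.1 ha with rfl | ha
        · rcases hxy with ⟨rfl, rfl⟩ | ⟨rfl, rfl⟩ <;> simp
        · exact ⟨List.mem_cons_of_mem _ (i2 a ha).1, List.mem_cons_of_mem _ (i2 a ha).2⟩

theorem cnt_ne {es : List ℕ} {a : ℕ} (h : cnt es a ≠ 0) : a ∈ es := by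
  by_contra hn
  exact h (by simp [cnt, List.count_eq_zero_of_not_mem hn])

theorem ind_sum (x : ℕ) (L : List ℕ) (hL : L.Nodup) :
    (L.map (ind x)).sum = if x ∈ L then 1 else 0 := by
  induction L with
  | nil => simp
  | cons y L ih =>
    rw [List.nodup_cons] at hL
    rw [List.map_cons, List.sum_cons, ih hL.2]
    by_cases h : x = y
    · subst h; simp [ind, hL.1]
    · simp [ind, h]

theorem Bf_ind (u : ℕ) (f : ℕ → ZMod 2) (p q : List ℕ) (h1 : u ∉ p) (h2 : u ∉ q) :
    Bf (ind u) f (p ++ u :: q) = (q.map f).sum := by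
  have e : ∀ l : List ℕ, u ∉ l → ∀ z ∈ l, ind u z = 0 := by
    intro l hl z hz
    exact ind_ne (by rintro rfl; exact hl hz)
  have s0 : (p.map (ind u)).sum = 0 := by
    rw [map_sum_congr (f' := fun _ => 0) (e p h1)]; simp
  rw [Bf_append, Bf_zero (e p h1), s0, Bf, Bf_zero (e q h2)]
  simp [ind]

end DGr

open DGr

theorem Construction.grounded {D : DGr} {LW LE : List ℕ} (h : Construction D LW LE)
    (hD : D.IsDGraph) : D.GroundedIn false LE := by
  intro v u w hb vs1 es1 hp1 t vs2 es2 ht hp2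
  by_contra hn
  push Not at hn
  have ht : D.XVertex true t := ht
  obtain ⟨l1, l2, -, -⟩ := h.lists
  rw [BtwL_iff l2.1] at hb
  obtain ⟨hv, hu, hw, hb⟩ := hb
  obtain ⟨b1, c1⟩ := D.walk_bd es1 vs1 v w hp1.1.1 hp1.2.1 hp1.2.2
  obtain ⟨b2, c2⟩ := D.walk_bd es2 vs2 u t hp2.1.1 hp2.2.1 hp2.2.2
  have xv := (l2.2 v).1 hv
  have xu := (l2.2 u).1 hu
  have xw := (l2.2 w).1 hw
  have ch := h.chain (cnt es1) (cnt es2) ?_ ?_ ?_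
  · have z1 : ∀ z ∈ LW, D.bd (cnt es1) z = 0 := by
      intro z hz
      have hz := (l1.2 z).1 hz
      rw [b1, ind_ne, ind_ne, add_zero]
      · rintro rfl; exact no_iso hD hz xw
      · rintro rfl; exact no_iso hD hz xv
    have z2 : ∀ z ∈ LE, D.bd (cnt es2) z = ind u z := by
      intro z hz
      have hz := (l2.2 z).1 hz
      rw [b2, ind_ne (x := t), add_zero]
      rintro rfl; exact no_iso hD ht hz
    have s0 : (LW.map (D.bd (cnt es1))).sum = 0 := by
      rw [map_sum_congr (f' := fun _ => 0) z1]; simp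
    rw [Bf_append, Bf_zero z1, s0, Bf_reverse,
      Bf_congr (f' := ind u) (g' := fun z => ind v z + ind w z) z2 (fun z _ => b1 z)] at ch
    simp only [zero_mul, zero_add] at ch
    obtain ⟨p, q, rfl⟩ := List.append_of_mem hu
    have nd := l2.1
    simp only [List.nodup_append, List.nodup_cons, List.mem_cons] at nd
    obtain ⟨np, ⟨nuq, nq⟩, npq⟩ := nd
    have nup : u ∉ p := fun h => npq u h u (Or.inl rfl) rfl
    rw [Bf_ind u _ p q nup nuq, List.sum_map_add] at ch
    rw [ind_sum v q nq, ind_sum w q nq] at ch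
    have iu : (p ++ u :: q).idxOf u = p.length := by
      rw [List.idxOf_append_of_notMem nup]; simp
    have key : ∀ x ∈ p ++ u :: q, (x ∈ q ↔ p.length < (p ++ u :: q).idxOf x) := by
      intro x hx
      constructor
      · intro hxq
        have hxp : x ∉ p := fun h => npq x h x (Or.inr hxq) rfl
        have hxu : u ≠ x := by rintro rfl; exact nuq hxq
        rw [List.idxOf_append_of_notMem hxp, List.idxOf_cons_ne _ hxu]
        omega
      · intro hlt
        simp only [List.mem_append, List.mem_cons] at hx
        rcases hx with hx | rfl | hx
        · rw [List.idxOf_append_of_mem hx] at hlt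
          have := List.idxOf_lt_length_of_mem hx
          omega
        · omega
        · exact hx
    rw [iu] at hb
    rcases hb with ⟨i1, i2⟩ | ⟨i1, i2⟩
    · rw [if_neg (fun h => by have := (key v hv).1 h; omega), if_pos ((key w hw).2 i2)] at ch
      simp at ch
    · rw [if_pos ((key v hv).2 i2), if_neg (fun h => by have := (key w hw).1 h; omega)] at ch
      simp at ch
  · intro z hz
    rw [b1, ind_ne, ind_ne, add_zero]
    · rintro rfl; exact hz.2.2 xw
    · rintro rfl; exact hz.2.2 xv
  · intro z hz
    rw [b2, ind_ne, ind_ne, add_zero]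
    · rintro rfl; exact hz.2.1 ht
    · rintro rfl; exact hz.2.2 xu
  · intro a ha b hb' h1 h2 z h3 h4
    have k1 := c1 a (cnt_ne h1)
    have k2 := c2 b (cnt_ne h2)
    refine hn z ?_ ?_
    · rcases h3 with rfl | rfl
      exacts [k1.1, k1.2]
    · rcases h4 with rfl | rfl
      exacts [k2.1, k2.2]

theorem Construction.lemU {D : DGr} {LW L Λ : List ℕ} (h : Construction D LW L)
    (hD : D.IsDGraph) (h1 : D.IsListOfX false Λ) (h2 : D.GroundedIn false Λ) :
    ∃ LW', Construction D LW' Λ := by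
  obtain ⟨w, hw⟩ := List.exists_mem_of_ne_nil _ h.lists.2.2.1
  have hw := (h.lists.1.2 w).1 hw
  refine list_main (fun L => ∃ LW, Construction D LW L)
    {K | K = Set.univ ∨ ∃ p, D.Sep K p} Λ h1.1 ?_ ?_ ?_ (Or.inl rfl) ?_ L ⟨LW, h⟩
  · rintro L ⟨LW, h⟩
    exact ⟨h.lists.2.1.1, fun z => by rw [h.lists.2.1.2, h1.2]⟩
  · rintro l1 s l2 K (rfl | ⟨p, hp⟩) ⟨LW, h⟩ k1 k2 k3
    · have e1 : l1 = [] := List.eq_nil_iff_forall_not_mem.2 (fun z hz => k2 z hz trivial)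
      have e2 : l2 = [] := List.eq_nil_iff_forall_not_mem.2 (fun z hz => k3 z hz trivial)
      subst e1 e2
      exact ⟨LW.reverse, by simpa using h.rev⟩
    · exact ⟨LW, h.lemR K p hp l1 s l2 rfl k1 k2 k3⟩
  · rintro K (rfl | ⟨p, hp⟩) K' (rfl | ⟨p', hp'⟩)
    · left; simp
    · right; exact ⟨p', by simpa using hp'⟩
    · right; exact ⟨p, by simpa using hp⟩
    · right; exact sep_inter hD.2.2.2.1 hw hp hp'
  · rintro L a x b ⟨LW, h⟩ k1 k2
    obtain ⟨K, p, k3, k4⟩ := lemInt hD.1 hD.2.2.1 hD.2.2.2.1 hw h.lists.2.1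
      (h.grounded hD) k1 (h2 _ _ _ k2)
    exact ⟨K, Or.inr ⟨p, k3⟩, k4⟩

/- ===== Part 9: duality ===== -/
namespace DGr

def op (G : DGr) : DGr := ⟨G.A, G.V, G.E, G.W⟩

theorem op_Xf (G : DGr) (X : Bool) : G.op.Xf X = G.Xf (!X) := by cases X <;> rfl

theorem op_XVertex (G : DGr) (X : Bool) (v : ℕ) : G.op.XVertex X v ↔ G.XVertex (!X) v := by
  unfold XVertex; rw [op_Xf]; rfl

theorem op_XEdge (G : DGr) (X : Bool) (a : ℕ) : G.op.XEdge X a ↔ G.XEdge (!X) a := by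
  unfold XEdge; rw [op_Xf, op_XVertex]; rfl

theorem op_inner (G : DGr) (v : ℕ) : G.op.InnerVertex v ↔ G.InnerVertex v := by
  unfold InnerVertex; rw [op_XVertex, op_XVertex]
  exact and_congr_right fun _ => And.comm

theorem op_semiwalk (G : DGr) (vs es : List ℕ) (h : G.IsSemiwalk vs es) :
    G.op.IsSemiwalk vs es :=
  ⟨h.1, h.2.1, h.2.2.1, fun i a u v h1 h2 h3 => by
    have := h.2.2.2 i a u v h1 h2 h3
    simp only [op]; tauto⟩

theorem op_FT (G : DGr) {u v : ℕ} {vs es : List ℕ} (h : G.SemipathFT u v vs es) :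
    G.op.SemipathFT u v vs es := ⟨⟨op_semiwalk G _ _ h.1.1, h.1.2⟩, h.2⟩

theorem op_walk (G : DGr) (vs es : List ℕ) (h : G.op.IsWalk vs es) :
    G.IsWalk vs.reverse es.reverse := by
  obtain ⟨h1, h2, h3, h4⟩ := h
  refine ⟨by simpa using h1, fun v hv => h2 v (by simpa using hv),
    fun v hv => h3 v (by simpa using hv), ?_⟩
  intro i a u v k1 k2 k3
  have hi : i < es.length := by
    have := (List.getElem?_eq_some_iff.1 k1).1
    simpa using this
  rw [List.getElem?_reverse (by omega)] at k1 k2 k3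
  have := h4 (es.length - 1 - i) a v u k1 (by rw [← k3]; congr 1; omega) (by rw [← k2]; congr 1; omega)
  exact ⟨this.2, this.1⟩

theorem op_acyclic (G : DGr) (h : G.Acyclic) : G.op.Acyclic := by
  rintro vs es ⟨h1, h2, h3, h4⟩
  refine h vs.reverse es.reverse ⟨op_walk G _ _ h1, by simpa using h2, by simpa using h3.symm, ?_⟩
  obtain ⟨b, es', rfl⟩ := List.exists_cons_of_ne_nil h2
  have hl := h1.1
  match vs, hl, h3, h4 with
  | [], hl, h3, h4 => simp at hl
  | [x], hl, h3, h4 => simp at hl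
  | x :: y :: vs, hl, h3, h4 =>
    rw [List.getLast?_cons_cons, List.head?_cons] at h3
    rw [List.dropLast_cons_of_ne_nil (by simp)] at h4
    obtain ⟨m, z, hm⟩ : ∃ m z, y :: vs = m ++ [z] :=
      ⟨_, _, (List.dropLast_append_getLast (l := y :: vs) (by simp)).symm⟩
    rw [hm] at h3 h4 ⊢
    simp only [List.getLast?_append, List.getLast?_singleton, Option.some_or, Option.some.injEq] at h3
    subst h3
    have e : (x :: (m ++ [x])).reverse.dropLast = x :: m.reverse := by
      simp only [List.reverse_cons, List.reverse_append, List.reverse_nil, List.nil_append,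
        List.singleton_append]
      rw [List.dropLast_concat]
    rw [e]
    simp only [List.dropLast_concat, List.nodup_cons, List.mem_reverse, List.nodup_reverse] at h4 ⊢
    exact h4

theorem op_dgraph {G : DGr} (h : G.IsDGraph) : G.op.IsDGraph := by
  obtain ⟨h1, h2, h3, h4, v, hv⟩ := h
  refine ⟨fun a ha => (h1 a ha).symm, op_acyclic G h2, ?_, ?_, v, (op_inner G v).2 hv⟩
  · intro X a ha b hb hne
    rw [op_Xf]
    exact h3 (!X) a ((op_XEdge G X a).1 ha) b hb hne
  · intro u hu v hv hne
    obtain ⟨vs, es, k⟩ := h4 u hu v hv hne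
    exact ⟨vs, es, op_FT G k⟩

theorem op_basic {G : DGr} (h : G.IsBasicDGraph) : G.op.IsBasicDGraph := by
  refine ⟨op_dgraph h.1, ?_⟩
  obtain ⟨v, hv, hu⟩ := h.2
  exact ⟨v, (op_inner G v).2 hv, fun y hy => hu y ((op_inner G y).1 hy)⟩

theorem op_list {G : DGr} {X : Bool} {L : List ℕ} (h : G.IsListOfX X L) :
    G.op.IsListOfX (!X) L := by
  refine ⟨h.1, fun v => ?_⟩
  rw [op_XVertex, Bool.not_not]; exact h.2 v

theorem op_grounded {G : DGr} {X : Bool} {L : List ℕ} (h : G.GroundedIn X L) :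
    G.op.GroundedIn (!X) L := by
  intro v u w hb vs1 es1 h1 t vs2 es2 ht h2
  rw [op_XVertex, Bool.not_not] at ht
  exact h v u w hb vs1 es1 (op_FT G.op h1) t vs2 es2 ht (op_FT G.op h2)

theorem op_img {GW GE : DGr} (h : GW.JuncDefined GE) :
    (GE.A ∩ GW.A).image GE.W = (GW.A ∩ GE.A).image GW.E := by
  rw [Finset.inter_comm]
  refine Finset.image_congr ?_
  intro a ha
  exact (h.2.2.2.1 a ha).1.symm

theorem op_junc {GW GE : DGr} (h : GW.JuncDefined GE) :
    GE.op.junc GW.op = (GW.junc GE).op := by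
  have h1 := op_img h
  simp only [op, junc, DGr.mk.injEq]
  refine ⟨Finset.union_comm _ _, ?_, rfl, rfl⟩
  rw [h1, Finset.union_comm]

theorem op_juncDefined {GW GE : DGr} (h : GW.JuncDefined GE) : GE.op.JuncDefined GW.op := by
  refine ⟨op_dgraph h.2.1, op_dgraph h.1, ?_, ?_, ?_⟩
  · show (GE.A ∩ GW.A).Nonempty
    rw [Finset.inter_comm]; exact h.2.2.1
  · intro a ha
    have ha : a ∈ GE.A ∩ GW.A := ha
    rw [Finset.inter_comm] at ha
    have := h.2.2.2.1 a ha
    rw [op_XEdge, op_XEdge]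
    exact ⟨this.1.symm, this.2.2, this.2.1⟩
  · show GE.V ∩ GW.V = (GE.A ∩ GW.A).image GE.W
    rw [op_img h, Finset.inter_comm]; exact h.2.2.2.2

end DGr

open DGr

theorem Construction.op {D : DGr} {LW LE : List ℕ} (h : Construction D LW LE) :
    Construction D.op LE LW := by
  refine Construction.ind' (motive := fun D LW LE => Construction D.op LE LW) ?_ ?_ h
  · intro G LW LE hG h1 h2
    exact .basic _ _ _ (op_basic hG) (op_list h2) (op_list h1)
  · intro GW GE LWW LEE Φe Ξ Ψe Φw Ψw c1 c2 hJ hΞ hΦ hΨ he hw hX ih1 ih2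
    rw [← op_junc hJ]
    exact ih2.box' ih1 (op_juncDefined hJ) hΞ hΦ.symm hΨ.symm (fun z hz => (hw z hz).2)

theorem Construction.lemU' {D : DGr} {L LE Λ : List ℕ} (h : Construction D L LE)
    (hD : D.IsDGraph) (h1 : D.IsListOfX true Λ) (h2 : D.GroundedIn true Λ) :
    ∃ LE', Construction D Λ LE' := by
  obtain ⟨L', h'⟩ := h.op.lemU (op_dgraph hD) (op_list h1) (op_grounded h2)
  exact ⟨L', h'.op⟩

theorem Construction.box_compat {GW GE : DGr} {LW LE Λ₁ Λ₂ : List ℕ}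
    (c1 : Construction GW LW Λ₁) (c2 : Construction GE Λ₂ LE) (hJ : GW.JuncDefined GE)
    (hc : ListCompat Λ₁ Λ₂) : ∃ LW LE, Construction (GW.junc GE) LW LE := by
  have m1 := c1.lists.2.1
  have m2 := c2.lists.1
  have hmem : ∀ z, z ∈ Λ₁ → z ∉ Λ₂ → z ∉ GE.V := by
    intro z h1 h2 h3
    exact h2 ((m2.2 z).2 (hJ.comE ((m1.2 z).1 h1).1 h3))
  obtain ⟨Φ, Ξ, Ψ, hΞ, -, -, -, d1, d2, d3, ⟨rfl, rfl⟩ | ⟨rfl, rfl⟩ | ⟨rfl, rfl⟩ | ⟨rfl, rfl⟩⟩ := hc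
  · refine ⟨_, _, Construction.box' (Φe := Φ) (Ξ := Ξ) (Ψe := []) (Φw := []) (Ψw := Ψ)
      (by simpa using c1) (by simpa using c2) hJ hΞ (by simp) (by simp) ?_⟩
    intro z hz
    simp only [List.not_mem_nil, or_false] at hz
    exact hmem z (by simp [hz]) (by have := d1 hz; have := d2 hz; simp; tauto)
  · refine ⟨_, _, Construction.box' (Φe := []) (Ξ := Ξ) (Ψe := Ψ) (Φw := Φ) (Ψw := [])
      (by simpa using c1) (by simpa using c2) hJ hΞ (by simp) (by simp) ?_⟩
    intro z hz
    simp only [List.not_mem_nil, false_or] at hz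
    exact hmem z (by simp [hz]) (by have := d2.symm hz; have := d3.symm hz; simp; tauto)
  · refine ⟨_, _, Construction.box' (Φe := Φ) (Ξ := Λ₂) (Ψe := Ψ) (Φw := []) (Ψw := [])
      (by simpa using c1) (by simpa using c2) hJ hΞ (by simp) (by simp) ?_⟩
    intro z hz
    refine hmem z (by simp; tauto) ?_
    rcases hz with hz | hz
    · exact d1 hz
    · exact d3.symm hz
  · exact ⟨_, _, Construction.box' (Φe := []) (Ξ := Λ₁) (Ψe := []) (Φw := Φ) (Ψw := Ψ)
      (by simpa using c1) (by simpa using c2) hJ hΞ (by simp) (by simp) (by simp)⟩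

theorem basic_lists {G : DGr} (X : Bool) : ∃ L, G.IsListOfX X L := by
  classical
  refine ⟨(G.V.filter (fun v => G.XVertex X v)).toList, Finset.nodup_toList _, fun v => ?_⟩
  rw [Finset.mem_toList, Finset.mem_filter]
  exact ⟨fun h => h.2, fun h => ⟨h.1, h⟩⟩
/-- **Theorem 4.4.5**: for every P″-graph `D` there is a construction whose root
graph is `D`; in other words, every P″-graph is a P′-graph. -/
theorem p2_graphs_are_p1_graphs (D : DGr) (h : IsP2Graph D) :
    ∃ LW LE : List ℕ, Construction D LW LE := by
    induction h with
  | basic G hG =>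
    obtain ⟨LW, h1⟩ := basic_lists (G := G) true
    obtain ⟨LE, h2⟩ := basic_lists (G := G) false
    exact ⟨LW, LE, .basic G LW LE hG h1 h2⟩
  | box GW GE _ _ hP ih1 ih2 =>
    obtain ⟨LW, LE, c1⟩ := ih1
    obtain ⟨LW', LE', c2⟩ := ih2
    obtain ⟨hJ, Λ₁, Λ₂, k1, k2, k3, k4, k5⟩ := hP
    obtain ⟨_, e1⟩ := c1.lemU hJ.1 k1 k2
    obtain ⟨_, e2⟩ := c2.lemU' hJ.2.1 k3 k4
    exact e1.box_compat e2 hJ k5
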